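/- arXiv:1708.05378 — 3 statements merged into one kernel-verified Lean document; each statement's English description precedes it below -/
import Mathlib

section
/- Let k be an algebraically closed field of characteristic zero and let f ∈ M_d(k⟨x₁,…,x_g⟩) be an atom such that f(α) ∈ M_d(k) is invertible for some scalar point α ∈ k^g. Then there exist n ∈ ℕ and X ∈ M_n(k)^g such that the kernel of the matrix f(X) ∈ M_{dn}(k) is exactly one-dimensional. -/
open Matrix MvPolynomial

noncomputable section

/-- Entrywise evaluation of a `d × d` matrix over the free algebra at a `g`-tuple of
`n × n` matrices over a commutative `k`-algebra `R`, as a `(dn) × (dn)` matrix. -/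
def matEval {k : Type*} [CommRing k] {g d n : ℕ} {R : Type*} [CommRing R] [Algebra k R]
    (f : Matrix (Fin d) (Fin d) (FreeAlgebra k (Fin g)))
    (X : Fin g → Matrix (Fin n) (Fin n) R) :
    Matrix (Fin d × Fin n) (Fin d × Fin n) R :=
  Matrix.of fun p q => (FreeAlgebra.lift k X (f p.1 q.1)) p.2 q.2

/-- Evaluation of a noncommutative polynomial at a `g`-tuple of matrices. -/
def scalarEval {k : Type*} [CommRing k] {g n : ℕ} {R : Type*} [CommRing R] [Algebra k R]
    (f : FreeAlgebra k (Fin g)) (X : Fin g → Matrix (Fin n) (Fin n) R) :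
    Matrix (Fin n) (Fin n) R :=
  FreeAlgebra.lift k X f

/-- An atom of a matrix ring: a non-invertible element that is not a product of two
non-invertible elements. -/
def MatAtom {R : Type*} [Ring R] {d : ℕ} (f : Matrix (Fin d) (Fin d) R) : Prop :=
  ¬IsUnit f ∧ ∀ u v : Matrix (Fin d) (Fin d) R, f = u * v → IsUnit u ∨ IsUnit v

/-- The block-diagonal sum `f ⊕ I_e`. -/
def dSum {R : Type*} [Ring R] {d : ℕ} (f : Matrix (Fin d) (Fin d) R) (e : ℕ) :
    Matrix (Fin (d + e)) (Fin (d + e)) R :=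
  Matrix.reindex finSumFinEquiv finSumFinEquiv (Matrix.fromBlocks f 0 0 1)

/-- Stable associativity of square matrices over a ring. -/
def StablyAssociated {R : Type*} [Ring R] {d₁ d₂ : ℕ}
    (f₁ : Matrix (Fin d₁) (Fin d₁) R) (f₂ : Matrix (Fin d₂) (Fin d₂) R) : Prop :=
  ∃ (e₁ e₂ : ℕ) (h : d₁ + e₁ = d₂ + e₂)
    (P Q : Matrix (Fin (d₁ + e₁)) (Fin (d₁ + e₁)) R),
    IsUnit P ∧ IsUnit Q ∧
      dSum f₁ e₁ = P * Matrix.reindex (finCongr h).symm (finCongr h).symm (dSum f₂ e₂) * Q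

/-- A monic linear pencil as a matrix over the free algebra. -/
def pencilMat {k : Type*} [CommRing k] {g d : ℕ} (A : Fin g → Matrix (Fin d) (Fin d) k) :
    Matrix (Fin d) (Fin d) (FreeAlgebra k (Fin g)) :=
  1 - ∑ j, (A j).map fun a => a • FreeAlgebra.ι k j

/-- The `g`-tuple of `n × n` generic matrices. -/
def genX (k : Type*) [CommRing k] (g n : ℕ) :
    Fin g → Matrix (Fin n) (Fin n) (MvPolynomial (Fin g × Fin n × Fin n) k) :=
  fun j => Matrix.of fun ι κ => MvPolynomial.X (j, ι, κ)

namespace FreeAlgebra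

variable {k : Type*} [Field k] {g : ℕ} (α : Fin g → k)

/-- The Fox derivatives at `α`, packaged with evaluation at `α` as an algebra homomorphism into
upper triangular matrices. -/
def foxHom (j : Fin g) :
    FreeAlgebra k (Fin g) →ₐ[k] Matrix (Fin 2) (Fin 2) (FreeAlgebra k (Fin g)) :=
  lift k fun i => !![algebraMap k _ (α i), if i = j then 1 else 0; 0, ι k i]

/-- The Fox derivative in the direction `j` at the scalar point `α`. -/
def fox (j : Fin g) : FreeAlgebra k (Fin g) →ₗ[k] FreeAlgebra k (Fin g) where
  toFun a := foxHom α j a 0 1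
  map_add' a b := by simp
  map_smul' c a := by simp

/-- The generator `x_j - α_j` of the ideal of the scalar point `α`. -/
def shift (j : Fin g) : FreeAlgebra k (Fin g) := ι k j - algebraMap k _ (α j)

lemma foxHom_eq (j : Fin g) (a : FreeAlgebra k (Fin g)) :
    foxHom α j a = !![algebraMap k _ (lift k α a), fox α j a; 0, a] := by
  have h : foxHom α j a 0 0 = algebraMap k _ (lift k α a) ∧
      foxHom α j a 1 0 = 0 ∧ foxHom α j a 1 1 = a := by
    induction a using FreeAlgebra.induction with
    | grade0 r => simp [Matrix.algebraMap_matrix_apply]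
    | grade1 i => simp [foxHom]
    | mul a b ha hb => simp [Matrix.mul_apply, Fin.sum_univ_two, ha, hb]
    | add a b ha hb => simp [ha, hb]
  ext i l
  fin_cases i <;> fin_cases l <;> simp [h, fox]

@[simp] lemma fox_algebraMap (j : Fin g) (c : k) : fox α j (algebraMap k _ c) = 0 := by
  simp [fox, Matrix.algebraMap_matrix_apply]

@[simp] lemma fox_one (j : Fin g) : fox α j 1 = 0 := by
  simpa using fox_algebraMap α j 1

@[simp] lemma fox_ι (j i : Fin g) : fox α j (ι k i) = if i = j then 1 else 0 := by
  simp [fox, foxHom]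

lemma fox_mul (j : Fin g) (a b : FreeAlgebra k (Fin g)) :
    fox α j (a * b) = fox α j a * b + lift k α a • fox α j b := by
  have h := congrFun (congrFun (map_mul (foxHom α j) a b) 0) 1
  rw [foxHom_eq, foxHom_eq α j a, foxHom_eq α j b] at h
  simpa [Matrix.mul_apply, Fin.sum_univ_two, Algebra.smul_def, add_comm] using h

@[simp] lemma lift_shift (j : Fin g) : lift k α (shift α j) = 0 := by simp [shift]

@[simp] lemma fox_shift (i j : Fin g) : fox α j (shift α i) = if i = j then 1 else 0 := by
  simp [shift]

lemma eq_add_sum_shift_mul_fox (a : FreeAlgebra k (Fin g)) :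
    a = algebraMap k _ (lift k α a) + ∑ j, shift α j * fox α j a := by
  induction a using FreeAlgebra.induction with
  | grade0 r => simp
  | grade1 i => simp [shift]
  | mul a b ha hb =>
    have ha' : ∑ j, shift α j * fox α j a = a - algebraMap k _ (lift k α a) :=
      eq_sub_of_add_eq' ha.symm
    have hb' : ∑ j, shift α j * fox α j b = b - algebraMap k _ (lift k α b) :=
      eq_sub_of_add_eq' hb.symm
    simp only [fox_mul, mul_add, Finset.sum_add_distrib, ← mul_assoc, ← Finset.sum_mul,
      mul_smul_comm, ← Finset.smul_sum, ha', hb', map_mul, sub_mul, smul_sub]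
    simp [Algebra.smul_def]
  | add a b ha hb =>
    conv_lhs => rw [ha, hb]
    simp only [map_add, mul_add, Finset.sum_add_distrib]
    abel

/-- The filtration of the free algebra by degree, shifted by one: `degLT α n` consists of the
elements of degree less than `n`. -/
def degLT : ℕ → Submodule k (FreeAlgebra k (Fin g))
  | 0 => ⊥
  | n + 1 => ⨅ j, (degLT n).comap (fox α j)

@[simp] lemma mem_degLT_zero {a : FreeAlgebra k (Fin g)} : a ∈ degLT α 0 ↔ a = 0 := Iff.rfl

lemma mem_degLT_succ {n : ℕ} {a : FreeAlgebra k (Fin g)} :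
    a ∈ degLT α (n + 1) ↔ ∀ j, fox α j a ∈ degLT α n := by
  simp [degLT]

lemma degLT_mono : Monotone (degLT (k := k) α) := by
  refine monotone_nat_of_le_succ fun n => ?_
  induction n with
  | zero => exact bot_le
  | succ n ih => exact fun a ha => (mem_degLT_succ α).2 fun j => ih ((mem_degLT_succ α).1 ha j)

lemma fox_mem_degLT {n : ℕ} {a : FreeAlgebra k (Fin g)} (ha : a ∈ degLT α n) (j : Fin g) :
    fox α j a ∈ degLT α (n - 1) := by
  cases n with
  | zero => simp_all
  | succ n => exact (mem_degLT_succ α).1 ha j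

lemma algebraMap_mem_degLT {n : ℕ} (hn : 1 ≤ n) (c : k) :
    algebraMap k (FreeAlgebra k (Fin g)) c ∈ degLT α n :=
  degLT_mono α hn ((mem_degLT_succ α).2 fun j => by simp)

lemma one_mem_degLT {n : ℕ} (hn : 1 ≤ n) : (1 : FreeAlgebra k (Fin g)) ∈ degLT α n := by
  simpa using algebraMap_mem_degLT α hn 1

lemma shift_mem_degLT (j : Fin g) : shift α j ∈ degLT α 2 :=
  (mem_degLT_succ α).2 fun i => by
    rw [fox_shift]
    split_ifs
    exacts [one_mem_degLT α le_rfl, zero_mem _]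

lemma eq_algebraMap_of_mem_degLT_one {a : FreeAlgebra k (Fin g)} (ha : a ∈ degLT α 1) :
    a = algebraMap k _ (lift k α a) := by
  have h : ∀ j, fox α j a = 0 := by simpa [mem_degLT_succ] using ha
  simpa [h] using eq_add_sum_shift_mul_fox α a

lemma mul_mem_degLT {n m : ℕ} {a b : FreeAlgebra k (Fin g)} (ha : a ∈ degLT α (n + 1))
    (hb : b ∈ degLT α m) : a * b ∈ degLT α (n + m) := by
  induction n generalizing a with
  | zero =>
    rw [eq_algebraMap_of_mem_degLT_one α ha, ← Algebra.smul_def, zero_add]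
    exact Submodule.smul_mem _ _ hb
  | succ n ih =>
    rw [Nat.add_right_comm, mem_degLT_succ]
    intro j
    rw [fox_mul]
    refine add_mem (ih ((mem_degLT_succ α).1 ha j)) (Submodule.smul_mem _ _ ?_)
    exact degLT_mono α (by omega) (fox_mem_degLT α hb j)

lemma exists_mem_degLT (a : FreeAlgebra k (Fin g)) : ∃ n, a ∈ degLT α n := by
  induction a using FreeAlgebra.induction with
  | grade0 r => exact ⟨1, algebraMap_mem_degLT α le_rfl r⟩
  | grade1 i =>
    refine ⟨2, (mem_degLT_succ α).2 fun j => ?_⟩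
    rw [fox_ι]
    split_ifs
    exacts [one_mem_degLT α le_rfl, zero_mem _]
  | mul a b ha hb =>
    obtain ⟨n, hn⟩ := ha
    obtain ⟨m, hm⟩ := hb
    exact ⟨n + m, mul_mem_degLT α (degLT_mono α n.le_succ hn) hm⟩
  | add a b ha hb =>
    obtain ⟨n, hn⟩ := ha
    obtain ⟨m, hm⟩ := hb
    exact ⟨max n m, add_mem (degLT_mono α (le_max_left n m) hn)
      (degLT_mono α (le_max_right n m) hm)⟩

instance finiteDimensional_degLT (n : ℕ) : FiniteDimensional k (degLT (k := k) α n) := by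
  induction n with
  | zero => exact inferInstanceAs (FiniteDimensional k (⊥ : Submodule k (FreeAlgebra k (Fin g))))
  | succ n ih =>
    let F : degLT (k := k) α (n + 1) →ₗ[k] k × (Fin g → degLT (k := k) α n) :=
      ((lift k α).toLinearMap.comp (Submodule.subtype _)).prod
        (LinearMap.pi fun j => (fox α j).restrict fun a ha => (mem_degLT_succ α).1 ha j)
    refine Module.Finite.of_injective F ((injective_iff_map_eq_zero F).2 fun a ha => ?_)
    have h1 : lift k α (a : FreeAlgebra k (Fin g)) = 0 := congrArg Prod.fst ha
    have h2 : ∀ j, fox α j (a : FreeAlgebra k (Fin g)) = 0 := fun j =>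
      congrArg Subtype.val (congrFun (congrArg Prod.snd ha) j)
    exact Subtype.ext (by simpa [h1, h2] using eq_add_sum_shift_mul_fox α a.1)

/-- An iterated Fox derivative extracting a nonzero coefficient of top degree. -/
lemma exists_iterated_fox {n : ℕ} {c : FreeAlgebra k (Fin g)} (hc : c ∉ degLT α n) :
    ∃ δ : FreeAlgebra k (Fin g) →ₗ[k] FreeAlgebra k (Fin g), δ c ≠ 0 ∧
      (∀ m b, b ∈ degLT α (m + n) → δ b ∈ degLT α m) ∧
      ∀ m a b, b ∈ degLT α (m + 1) → δ (a * b) - δ a * b ∈ degLT α m := by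
  induction n generalizing c with
  | zero => exact ⟨LinearMap.id, by simpa using hc, by simp, by simp⟩
  | succ n ih =>
    obtain ⟨j, hj⟩ := not_forall.1 (mt (mem_degLT_succ α).2 hc)
    obtain ⟨δ, h0, h1, h2⟩ := ih hj
    refine ⟨δ ∘ₗ fox α j, h0, fun m b hb => h1 _ _ ((mem_degLT_succ α).1 hb j),
      fun m a b hb => ?_⟩
    have h3 : δ (fox α j b) ∈ degLT α m :=
      h1 _ _ (degLT_mono α (Nat.le_add_right _ _) ((mem_degLT_succ α).1 hb j))
    simp only [LinearMap.comp_apply, fox_mul, map_add, map_smul]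
    rw [add_sub_right_comm]
    exact add_mem (h2 m _ _ hb) (Submodule.smul_mem _ _ h3)

end FreeAlgebra

namespace FreeAlgebra

variable {k : Type*} [Field k] {g : ℕ}

/-- The least `n` such that `a` has degree less than `n`. -/
def degSucc (α : Fin g → k) (a : FreeAlgebra k (Fin g)) : ℕ := sInf {n | a ∈ degLT α n}

lemma mem_degLT_iff (α : Fin g → k) {a : FreeAlgebra k (Fin g)} {n : ℕ} :
    a ∈ degLT α n ↔ degSucc α a ≤ n :=
  ⟨fun h => Nat.sInf_le h, fun h => degLT_mono α h (Nat.sInf_mem (exists_mem_degLT α a))⟩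

lemma degSucc_eq_zero (α : Fin g → k) {a : FreeAlgebra k (Fin g)} :
    degSucc α a = 0 ↔ a = 0 := by
  rw [← mem_degLT_zero α, mem_degLT_iff, Nat.le_zero]

variable {ι : Type*} [Fintype ι] [DecidableEq ι]

lemma isUnit_one_add_vecMulVec {R : Type*} [Ring R] {u v : ι → R} (h : v ⬝ᵥ u = 0) :
    IsUnit (1 + vecMulVec u v) := by
  have h : vecMulVec u v * vecMulVec u v = 0 := by
    rw [vecMulVec_mul_vecMulVec]
    simp [h]
  refine ⟨⟨_, 1 - vecMulVec u v, ?_, ?_⟩, rfl⟩ <;>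
    simp [mul_add, add_mul, mul_sub, sub_mul, h]

lemma exists_isUnit_mulVec_eq_single_of_eq_one {R : Type*} [Ring R] {h : ι → R} {i : ι}
    (hi : h i = 1) (i₀ : ι) : ∃ U : Matrix ι ι R, IsUnit U ∧ U *ᵥ h = Pi.single i₀ 1 := by
  have clear : ∀ h : ι → R, h i₀ = 1 → ∃ U : Matrix ι ι R, IsUnit U ∧ U *ᵥ h = Pi.single i₀ 1 :=
    fun h h0 => ⟨1 + vecMulVec (Pi.single i₀ 1 - h) (Pi.single i₀ 1),
      isUnit_one_add_vecMulVec (by simp [h0]), by simp [add_mulVec, vecMulVec_mulVec, h0]⟩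
  rcases eq_or_ne i i₀ with rfl | hne
  · exact clear h hi
  · set E : Matrix ι ι R := 1 + vecMulVec (Pi.single i₀ (1 - h i₀)) (Pi.single i 1) with hE
    obtain ⟨U, hU, hUh⟩ := clear (E *ᵥ h) (by simp [hE, add_mulVec, vecMulVec_mulVec, hi])
    exact ⟨U * E, hU.mul (isUnit_one_add_vecMulVec (by simp [hne])), by
      rw [← mulVec_mulVec, hUh]⟩

/-- Weak algorithm: in a right unimodular relation without constant entries, some entry
can be lowered in degree by subtracting left multiples of the other ones. -/
lemma exists_degree_reduction (α : Fin g → k) {c h : ι → FreeAlgebra k (Fin g)}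
    (hch : c ⬝ᵥ h = 1) (hh : ∀ i, degSucc α (h i) ≠ 1) :
    ∃ (i : ι) (r : ι → FreeAlgebra k (Fin g)), r i = 0 ∧
      degSucc α (h i + r ⬝ᵥ h) < degSucc α (h i) := by
  classical
  set s : Finset ι := Finset.univ.filter fun i => c i ≠ 0 ∧ h i ≠ 0 with hs
  have hsum : ∑ i ∈ s, c i * h i = 1 := by
    rw [← hch, dotProduct, hs, Finset.sum_filter]
    refine Finset.sum_congr rfl fun i _ => ?_
    by_cases h1 : c i = 0 <;> by_cases h2 : h i = 0 <;> simp [h1, h2]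
  have hne : s.Nonempty := by
    rw [Finset.nonempty_iff_ne_empty]
    intro h0
    rw [h0, Finset.sum_empty] at hsum
    have := congrArg (lift k α) hsum
    simp at this
  obtain ⟨i, his, hi⟩ := Finset.exists_max_image s
    (fun i => toLex (degSucc α (c i) + degSucc α (h i), degSucc α (h i))) hne
  have hact : ∀ l ∈ s, degSucc α (c l) ≠ 0 ∧ 2 ≤ degSucc α (h l) := by
    intro l hl
    obtain ⟨h1, h2⟩ := (Finset.mem_filter.1 hl).2
    rw [ne_eq, ← degSucc_eq_zero α] at h1 h2
    have := hh l
    exact ⟨h1, by omega⟩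
  obtain ⟨n, hn⟩ : ∃ n, degSucc α (c i) = n + 1 := Nat.exists_eq_succ_of_ne_zero (hact i his).1
  obtain ⟨m, hm⟩ : ∃ m, degSucc α (h i) = m + 2 := ⟨_, (Nat.sub_add_cancel (hact i his).2).symm⟩
  obtain ⟨δ, h0, h1, h2⟩ := exists_iterated_fox α (n := n) (c := c i)
    (by rw [mem_degLT_iff]; omega)
  have hconst : δ (c i) = algebraMap k _ (lift k α (δ (c i))) :=
    eq_algebraMap_of_mem_degLT_one α (h1 1 _ (by rw [mem_degLT_iff]; omega))
  set γ := lift k α (δ (c i)) with hγ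
  have hγ0 : γ ≠ 0 := by
    intro h
    rw [h, map_zero] at hconst
    exact h0 hconst
  set r : ι → FreeAlgebra k (Fin g) := fun l =>
    if l ∈ s ∧ l ≠ i ∧ degSucc α (h l) ≤ m + 2 then γ⁻¹ • δ (c l) else 0 with hr
  refine ⟨i, r, by simp [hr], ?_⟩
  rw [hm, Nat.lt_succ_iff, ← mem_degLT_iff]
  have key : ∀ l ∈ s, δ (c l * h l) -
      (if degSucc α (h l) ≤ m + 2 then δ (c l) else 0) * h l ∈ degLT α (m + 1) := by
    intro l hl
    split_ifs with hle
    · exact h2 _ _ _ ((mem_degLT_iff α).2 hle)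
    · have hlt := hi l hl
      rw [Prod.Lex.toLex_le_toLex] at hlt
      have hlt' : degSucc α (c l) + degSucc α (h l) < n + 1 + (m + 2) := by
        simp only at hlt
        omega
      obtain ⟨p, hp⟩ := Nat.exists_eq_succ_of_ne_zero (hact l hl).1
      rw [zero_mul, sub_zero]
      refine h1 _ _ (degLT_mono α ?_ (mul_mem_degLT α ((mem_degLT_iff α).2 hp.le)
        ((mem_degLT_iff α).2 le_rfl)))
      omega
  have hδ1 : δ 1 ∈ degLT α (m + 1) := h1 _ _ (one_mem_degLT α (by omega))
  have htot := sub_mem hδ1 (sum_mem key)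
  rw [Finset.sum_sub_distrib, ← map_sum, hsum, sub_sub_cancel] at htot
  have hrw : h i + r ⬝ᵥ h = γ⁻¹ • ∑ l ∈ s,
      (if degSucc α (h l) ≤ m + 2 then δ (c l) else 0) * h l := by
    rw [← Finset.add_sum_erase s _ his, if_pos hm.le, smul_add, hconst, ← Algebra.smul_def,
      smul_smul, inv_mul_cancel₀ hγ0, one_smul, dotProduct, Finset.smul_sum]
    congr 1
    rw [← Finset.sum_subset (Finset.subset_univ (s.erase i))]
    · refine Finset.sum_congr rfl fun l hl => ?_
      obtain ⟨hli, hls⟩ := Finset.mem_erase.1 hl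
      simp only [hr, hls, hli, ne_eq, not_false_eq_true, true_and]
      split_ifs <;> simp
    · intro l _ hl
      have : ¬(l ∈ s ∧ l ≠ i ∧ degSucc α (h l) ≤ m + 2) := fun h =>
        hl (Finset.mem_erase.2 ⟨h.2.1, h.1⟩)
      simp [hr, this]
  rw [hrw]
  exact Submodule.smul_mem _ _ htot

/-- The free algebra is a Hermite ring: unimodular columns can be reduced to unit vectors. -/
theorem exists_isUnit_mulVec_eq_single {c h : ι → FreeAlgebra k (Fin g)}
    (hch : c ⬝ᵥ h = 1) (i₀ : ι) :
    ∃ U : Matrix ι ι (FreeAlgebra k (Fin g)), IsUnit U ∧ U *ᵥ h = Pi.single i₀ 1 := by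
  let α : Fin g → k := 0
  induction hN : ∑ i, degSucc α (h i) using Nat.strong_induction_on generalizing c h with
  | _ N ih =>
  by_cases hh : ∀ i, degSucc α (h i) ≠ 1
  · obtain ⟨i, r, hri, hlt⟩ := exists_degree_reduction α hch hh
    have hU := isUnit_one_add_vecMulVec (u := Pi.single i 1) (v := r) (by simp [hri])
    set E := 1 + vecMulVec (Pi.single i 1) r with hE
    have hEh : E *ᵥ h = Function.update h i (h i + r ⬝ᵥ h) := by
      ext l
      rcases eq_or_ne l i with rfl | hl
      · simp [hE, add_mulVec, vecMulVec_mulVec]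
      · simp [hE, add_mulVec, vecMulVec_mulVec, hl]
    obtain ⟨u, hu⟩ := hU
    obtain ⟨U, hU', hUh⟩ := ih (∑ l, degSucc α ((E *ᵥ h) l)) (by
      rw [← hN, hEh]
      refine Finset.sum_lt_sum (fun l _ => ?_) ⟨i, Finset.mem_univ i, by simpa using hlt⟩
      rcases eq_or_ne l i with rfl | hl
      · simpa using hlt.le
      · simp [hl]) (c := c ᵥ* (↑u⁻¹ : Matrix ι ι (FreeAlgebra k (Fin g)))) (h := E *ᵥ h) (by
        rw [dotProduct_mulVec, vecMul_vecMul, ← hu, Units.inv_mul, vecMul_one, hch]) rfl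
    exact ⟨U * E, hU'.mul (hu ▸ u.isUnit), by rw [← mulVec_mulVec, hUh]⟩
  · push Not at hh
    obtain ⟨i, hi⟩ := hh
    have hconst := eq_algebraMap_of_mem_degLT_one α ((mem_degLT_iff α).2 hi.le)
    set γ := lift k α (h i) with hγ
    have hγ0 : γ ≠ 0 := by
      intro h
      rw [h, map_zero, ← degSucc_eq_zero α] at hconst
      omega
    obtain ⟨U, hU, hUh⟩ := exists_isUnit_mulVec_eq_single_of_eq_one (h := γ⁻¹ • h) (i := i)
      (by rw [Pi.smul_apply, hconst, Algebra.smul_def, ← map_mul, inv_mul_cancel₀ hγ0, map_one]) i₀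
    refine ⟨γ⁻¹ • U, hU.smul (Units.mk0 γ⁻¹ (inv_ne_zero hγ0)), by rw [smul_mulVec, ← mulVec_smul, hUh]⟩

end FreeAlgebra

section BlockMatrix

variable {R : Type*} [Ring R] {ι κ : Type*} [Fintype ι] [Fintype κ] [DecidableEq ι]
  [DecidableEq κ]

lemma isUnit_fromBlocks_one_iff {f : Matrix ι ι R} {r : Matrix κ ι R} :
    IsUnit (fromBlocks f 0 r (1 : Matrix κ κ R)) ↔ IsUnit f := by
  constructor
  · rintro ⟨u, hu⟩
    set w : Matrix (ι ⊕ κ) (ι ⊕ κ) R := (↑u⁻¹ : Matrix (ι ⊕ κ) (ι ⊕ κ) R) with hw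
    have h1 : fromBlocks f 0 r (1 : Matrix κ κ R) * w = 1 := by rw [← hu, hw, Units.mul_inv]
    have h2 : w * fromBlocks f 0 r (1 : Matrix κ κ R) = 1 := by rw [← hu, hw, Units.inv_mul]
    rw [← fromBlocks_toBlocks w, fromBlocks_multiply, ← fromBlocks_one, fromBlocks_inj] at h1 h2
    have h3 : w.toBlocks₁₂ = 0 := by simpa using h2.2.1
    exact ⟨⟨f, w.toBlocks₁₁, by simpa using h1.1, by simpa [h3] using h2.1⟩, rfl⟩
  · rintro ⟨u, rfl⟩
    refine ⟨⟨fromBlocks u 0 r 1, fromBlocks (↑u⁻¹ : Matrix ι ι R) 0 (-(r * (↑u⁻¹ : Matrix ι ι R))) 1, ?_, ?_⟩,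
      rfl⟩ <;> simp [fromBlocks_multiply, Matrix.mul_assoc]

end BlockMatrix

section Irreducible

variable {k : Type*} [Field k] {g : ℕ} {ι : Type*} [Fintype ι] [DecidableEq ι]

lemma irreducible_fromBlocks_unit {f : Matrix ι ι (FreeAlgebra k (Fin g))} (hf : Irreducible f) :
    Irreducible (fromBlocks f 0 0 (1 : Matrix Unit Unit (FreeAlgebra k (Fin g)))) := by
  refine ⟨mt isUnit_fromBlocks_one_iff.1 hf.not_isUnit, fun G H hGH => ?_⟩
  set h : ι ⊕ Unit → FreeAlgebra k (Fin g) := fun i => H i (Sum.inr ()) with hh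
  have hGh : G *ᵥ h = Pi.single (Sum.inr ()) 1 := by
    ext i
    have := congrFun (congrFun hGH i) (Sum.inr ())
    rw [Matrix.mul_apply] at this
    rw [mulVec, dotProduct, hh, ← this]
    rcases i with i | i <;> simp
  obtain ⟨U, ⟨u, rfl⟩, hUh⟩ := FreeAlgebra.exists_isUnit_mulVec_eq_single
    (c := G (Sum.inr ())) (h := h)
    (by simpa [mulVec] using congrFun hGh (Sum.inr ())) (Sum.inr ())
  set V : Matrix (ι ⊕ Unit) (ι ⊕ Unit) (FreeAlgebra k (Fin g)) :=
    (↑u⁻¹ : Matrix (ι ⊕ Unit) (ι ⊕ Unit) (FreeAlgebra k (Fin g))) with hV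
  have hVu : V * (u : Matrix (ι ⊕ Unit) (ι ⊕ Unit) (FreeAlgebra k (Fin g))) = 1 := u.inv_mul
  have hcol : ∀ i, (G * V) i (Sum.inr ()) = (Pi.single (Sum.inr ()) 1 : ι ⊕ Unit → FreeAlgebra k (Fin g)) i := fun i => by
    rw [← hGh, ← one_mulVec h, ← hVu, ← mulVec_mulVec, hUh, mulVec_mulVec]
    simp
  have hcol' : ∀ i, (u.1 * H) i (Sum.inr ()) = (Pi.single (Sum.inr ()) 1 : ι ⊕ Unit → FreeAlgebra k (Fin g)) i := fun i => by
    rw [← hUh]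
    rfl
  have key : ∀ M : Matrix (ι ⊕ Unit) (ι ⊕ Unit) (FreeAlgebra k (Fin g)),
      (∀ i, M i (Sum.inr ()) = (Pi.single (Sum.inr ()) 1 : ι ⊕ Unit → FreeAlgebra k (Fin g)) i) →
      M = fromBlocks M.toBlocks₁₁ 0 M.toBlocks₂₁ 1 := by
    intro M hM
    conv_lhs => rw [← fromBlocks_toBlocks M]
    congr 1
    · ext i j
      simpa [toBlocks₁₂] using hM (Sum.inl i)
    · ext i j
      simpa [toBlocks₂₂, Matrix.one_apply] using hM (Sum.inr ())
  have hprod : fromBlocks f 0 0 1 = (G * V) * (u.1 * H) := by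
    rw [hGH, Matrix.mul_assoc, ← Matrix.mul_assoc V, hVu, Matrix.one_mul]
  rw [key _ hcol, key _ hcol', fromBlocks_multiply, fromBlocks_inj] at hprod
  refine (hf.isUnit_or_isUnit (by simpa using hprod.1)).imp (fun h => ?_) fun h => ?_
  · have := isUnit_fromBlocks_one_iff (r := (G * V).toBlocks₂₁).2 h
    rw [← key _ hcol] at this
    exact (Units.isUnit_mul_units G u⁻¹).1 this
  · have := isUnit_fromBlocks_one_iff (r := (u.1 * H).toBlocks₂₁).2 h
    rw [← key _ hcol'] at this
    exact (Units.isUnit_units_mul u H).1 this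

/-- Enlarging an irreducible matrix over a free algebra by an identity block keeps it
irreducible. -/
theorem irreducible_fromBlocks (κ : Type*) [Fintype κ] [DecidableEq κ]
    {f : Matrix ι ι (FreeAlgebra k (Fin g))} (hf : Irreducible f) :
    Irreducible (fromBlocks f 0 0 (1 : Matrix κ κ (FreeAlgebra k (Fin g)))) := by
  have h : ∀ n : ℕ, Irreducible
      (fromBlocks f 0 0 (1 : Matrix (Fin n) (Fin n) (FreeAlgebra k (Fin g)))) := by
    intro n
    induction n with
    | zero =>
      rw [← MulEquiv.irreducible_iff (reindexAlgEquiv k (FreeAlgebra k (Fin g))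
        (Equiv.sumEmpty ι (Fin 0)))]
      exact hf
    | succ n ih =>
      rw [← MulEquiv.irreducible_iff (reindexAlgEquiv k (FreeAlgebra k (Fin g))
        ((Equiv.sumCongr (Equiv.refl ι) (finSumFinEquiv (m := n) (n := 1)).symm).trans
          ((Equiv.sumAssoc ι (Fin n) (Fin 1)).symm.trans
            (Equiv.sumCongr (Equiv.refl _) (Equiv.equivPUnit (Fin 1))))))]
      convert irreducible_fromBlocks_unit ih
      ext i j
      rcases i with (i | i) | i <;> rcases j with (j | j) | j <;>
        simp [Matrix.one_apply]
      · exact fun h => i.isLt.ne (by simpa using congrArg Fin.val h)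
      · exact fun h => j.isLt.ne' (by simpa using congrArg Fin.val h)
  rw [← MulEquiv.irreducible_iff (reindexAlgEquiv k (FreeAlgebra k (Fin g))
    (Equiv.sumCongr (Equiv.refl ι) (Fintype.equivFin κ)))]
  convert h (Fintype.card κ)
  ext i j
  rcases i with i | i <;> rcases j with j | j <;> simp [Matrix.one_apply]

end Irreducible

section Action

universe u v

variable {k : Type u} [Field k] {g : ℕ} {ι κ τ : Type*} [Fintype κ]
variable {V : Type v} [AddCommGroup V] [Module k V]

/-- The linear map `V^κ → V^ι` given by a matrix over the free algebra and a representation of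
the free algebra on `V`. -/
def matAct (φ : FreeAlgebra k (Fin g) →ₐ[k] Module.End k V)
    (f : Matrix ι κ (FreeAlgebra k (Fin g))) : (κ → V) →ₗ[k] (ι → V) :=
  LinearMap.pi fun i => ∑ l, φ (f i l) ∘ₗ LinearMap.proj l

variable (φ : FreeAlgebra k (Fin g) →ₐ[k] Module.End k V)

lemma matAct_apply (f : Matrix ι κ (FreeAlgebra k (Fin g))) (w : κ → V) (i : ι) :
    matAct φ f w i = ∑ l, φ (f i l) (w l) := by
  simp [matAct]

lemma matAct_add (f h : Matrix ι κ (FreeAlgebra k (Fin g))) :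
    matAct φ (f + h) = matAct φ f + matAct φ h := by
  ext1 w
  ext i
  simp [matAct_apply, Finset.sum_add_distrib]

lemma matAct_neg (f : Matrix ι κ (FreeAlgebra k (Fin g))) :
    matAct φ (-f) = -matAct φ f := by
  ext1 w
  ext i
  simp [matAct_apply]

lemma matAct_mul [Fintype τ] (f : Matrix ι κ (FreeAlgebra k (Fin g)))
    (h : Matrix κ τ (FreeAlgebra k (Fin g))) (w : τ → V) :
    matAct φ (f * h) w = matAct φ f (matAct φ h w) := by
  ext i
  simp only [matAct_apply, Matrix.mul_apply, map_sum, map_mul, LinearMap.sum_apply,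
    Module.End.mul_apply]
  exact Finset.sum_comm

lemma matAct_fromBlocks_elim {κ' ι' : Type*} [Fintype κ']
    (a : Matrix ι κ (FreeAlgebra k (Fin g))) (b : Matrix ι κ' (FreeAlgebra k (Fin g)))
    (c : Matrix ι' κ (FreeAlgebra k (Fin g))) (d : Matrix ι' κ' (FreeAlgebra k (Fin g)))
    (w : κ → V) (w' : κ' → V) :
    matAct φ (fromBlocks a b c d) (Sum.elim w w') =
      Sum.elim (matAct φ a w + matAct φ b w') (matAct φ c w + matAct φ d w') := by
  ext (i | i) <;> simp [matAct_apply]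

variable [Fintype ι]

lemma matAct_one [DecidableEq ι] (w : ι → V) :
    matAct φ (1 : Matrix ι ι (FreeAlgebra k (Fin g))) w = w := by
  ext i
  rw [matAct_apply, Finset.sum_eq_single i]
  · simp
  · intro l _ hl
    simp [Matrix.one_apply_ne hl.symm]
  · simp

lemma ker_matAct_le_mul (u : Matrix τ ι (FreeAlgebra k (Fin g)))
    (f : Matrix ι κ (FreeAlgebra k (Fin g))) :
    LinearMap.ker (matAct φ f) ≤ LinearMap.ker (matAct φ (u * f)) := fun w hw => by
  rw [LinearMap.mem_ker] at hw ⊢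
  rw [matAct_mul, hw, map_zero]

lemma ker_matAct_eq_bot_of_isUnit [DecidableEq ι] {f : Matrix ι ι (FreeAlgebra k (Fin g))}
    (hf : IsUnit f) : LinearMap.ker (matAct φ f) = ⊥ := by
  obtain ⟨u, rfl⟩ := hf
  refine LinearMap.ker_eq_bot'.2 fun w hw => ?_
  rw [← matAct_one φ w, ← u.inv_mul, matAct_mul, hw, map_zero]

lemma finrank_ker_matAct_linearization [DecidableEq κ] (c : Matrix ι ι (FreeAlgebra k (Fin g)))
    (y : Matrix ι κ (FreeAlgebra k (Fin g))) (z : Matrix κ ι (FreeAlgebra k (Fin g))) :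
    Module.finrank k (LinearMap.ker (matAct φ (fromBlocks c (-y) z 1))) =
      Module.finrank k (LinearMap.ker (matAct φ (c + y * z))) := by
  have mem_iff : ∀ w w', Sum.elim w w' ∈ LinearMap.ker (matAct φ (fromBlocks c (-y) z 1)) ↔
      w ∈ LinearMap.ker (matAct φ (c + y * z)) ∧ w' = -matAct φ z w := by
    intro w w'
    rw [LinearMap.mem_ker, LinearMap.mem_ker, matAct_fromBlocks_elim, matAct_one, matAct_neg,
      matAct_add, LinearMap.add_apply, LinearMap.neg_apply, matAct_mul, ← Sum.elim_zero_zero,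
      Sum.elim_eq_iff]
    constructor
    · rintro ⟨h1, h2⟩
      obtain rfl := eq_neg_of_add_eq_zero_right h2
      exact ⟨by simpa using h1, rfl⟩
    · rintro ⟨h1, rfl⟩
      exact ⟨by simpa using h1, add_neg_cancel _⟩
  let e : LinearMap.ker (matAct φ (fromBlocks c (-y) z 1)) →ₗ[k]
      LinearMap.ker (matAct φ (c + y * z)) :=
    (LinearMap.funLeft k V Sum.inl).restrict fun w hw => by
      rw [← Sum.elim_comp_inl_inr w] at hw
      exact ((mem_iff _ _).1 hw).1
  refine (LinearEquiv.ofBijective e ⟨(injective_iff_map_eq_zero e).2 ?_, ?_⟩).finrank_eq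
  · rintro ⟨w, hw⟩ h0
    have h0' : w ∘ Sum.inl = 0 := congrArg Subtype.val h0
    rw [← Sum.elim_comp_inl_inr w] at hw
    have := ((mem_iff _ _).1 hw).2
    rw [h0', map_zero, neg_zero] at this
    apply Subtype.ext
    change w = 0
    rw [← Sum.elim_comp_inl_inr w, h0', this, Sum.elim_zero_zero]
  · rintro ⟨w, hw⟩
    exact ⟨⟨Sum.elim w (-matAct φ z w), (mem_iff _ _).2 ⟨hw, rfl⟩⟩, rfl⟩

/-- Some finite-dimensional representation of the free algebra makes the kernel of `f`
one-dimensional. -/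
def HasOneDimKernel (f : Matrix ι κ (FreeAlgebra k (Fin g))) : Prop :=
  ∃ (V : Type u) (_ : AddCommGroup V) (_ : Module k V) (_ : FiniteDimensional k V)
    (φ : FreeAlgebra k (Fin g) →ₐ[k] Module.End k V),
    Module.finrank k (LinearMap.ker (matAct φ f)) = 1

lemma HasOneDimKernel.of_isUnit_mul [DecidableEq ι] {u f : Matrix ι ι (FreeAlgebra k (Fin g))}
    (hu : IsUnit u) (h : HasOneDimKernel (u * f)) : HasOneDimKernel f := by
  obtain ⟨V, _, _, _, φ, hφ⟩ := h
  obtain ⟨u, rfl⟩ := hu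
  refine ⟨V, _, _, ‹_›, φ, ?_⟩
  rw [← hφ, le_antisymm (ker_matAct_le_mul φ u.1 f)]
  have := ker_matAct_le_mul φ (↑u⁻¹ : Matrix ι ι (FreeAlgebra k (Fin g))) (u.1 * f)
  rwa [← Matrix.mul_assoc, u.inv_mul, Matrix.one_mul] at this

theorem HasOneDimKernel.exists_matEval {d : ℕ} {f : Matrix (Fin d) (Fin d) (FreeAlgebra k (Fin g))}
    (h : HasOneDimKernel f) : ∃ (n : ℕ) (X : Fin g → Matrix (Fin n) (Fin n) k),
      Module.finrank k (LinearMap.ker (matEval f X).mulVecLin) = 1 := by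
  obtain ⟨V, _, _, _, φ, hφ⟩ := h
  let b := Module.finBasis k V
  let X : Fin g → Matrix _ _ k := fun j => LinearMap.toMatrixAlgEquiv b (φ (FreeAlgebra.ι k j))
  refine ⟨_, X, ?_⟩
  have hX : ∀ a, FreeAlgebra.lift k X a = LinearMap.toMatrixAlgEquiv b (φ a) := by
    intro a
    have : FreeAlgebra.lift k X = (LinearMap.toMatrixAlgEquiv b).toAlgHom.comp φ :=
      FreeAlgebra.hom_ext (by ext1 j; simp [X])
    rw [this]
    rfl
  let e : (Fin d → V) ≃ₗ[k] (Fin d × Fin (Module.finrank k V) → k) :=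
    (LinearEquiv.piCongrRight fun _ => b.equivFun).trans (LinearEquiv.curry k k _ _).symm
  have he : ∀ w, (matEval f X).mulVecLin (e w) = e (matAct φ f w) := by
    intro w
    ext ⟨i, a⟩
    have h1 : ∀ l, (LinearMap.toMatrixAlgEquiv b (φ (f i l)) *ᵥ b.repr (w l)) a =
        b.repr (φ (f i l) (w l)) a := fun l =>
      congrFun (LinearMap.toMatrix_mulVec_repr b b _ _) a
    simp only [mulVec, dotProduct] at h1
    simp [e, matEval, mulVec, dotProduct, Fintype.sum_prod_type, hX, matAct_apply, h1]
  have hker : LinearMap.ker (matEval f X).mulVecLin =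
      (LinearMap.ker (matAct φ f)).map (e : (Fin d → V) →ₗ[k] _) := by
    ext w
    obtain ⟨w, rfl⟩ := e.surjective w
    rw [LinearMap.mem_ker, he, e.map_eq_zero_iff, Submodule.mem_map_equiv, e.symm_apply_apply,
      LinearMap.mem_ker]
  rw [hker, LinearEquiv.finrank_map_eq, hφ]

end Action

section Linearization

variable {k : Type*} [Field k] {g : ℕ} {ι κ : Type*} [Fintype ι] [Fintype κ] [DecidableEq ι]
  [DecidableEq κ]

/-- Higman's linearization trick preserves irreducibility. -/
lemma Irreducible.linearization {c : Matrix ι ι (FreeAlgebra k (Fin g))}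
    {y : Matrix ι κ (FreeAlgebra k (Fin g))} {z : Matrix κ ι (FreeAlgebra k (Fin g))}
    (h : Irreducible (c + y * z)) : Irreducible (fromBlocks c (-y) z 1) := by
  have hP : IsUnit (fromBlocks 1 y 0 1 : Matrix (ι ⊕ κ) (ι ⊕ κ) (FreeAlgebra k (Fin g))) :=
    ⟨⟨fromBlocks 1 y 0 1, fromBlocks 1 (-y) 0 1, by simp [fromBlocks_multiply],
      by simp [fromBlocks_multiply]⟩, rfl⟩
  have hQ : IsUnit (fromBlocks 1 0 (-z) 1 : Matrix (ι ⊕ κ) (ι ⊕ κ) (FreeAlgebra k (Fin g))) :=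
    ⟨⟨fromBlocks 1 0 (-z) 1, fromBlocks 1 0 z 1, by simp [fromBlocks_multiply],
      by simp [fromBlocks_multiply]⟩, rfl⟩
  have h' := irreducible_fromBlocks κ h
  have heq : fromBlocks (c + y * z) 0 0 (1 : Matrix κ κ _) =
      fromBlocks 1 y 0 1 * (fromBlocks c (-y) z 1 * fromBlocks 1 0 (-z) 1) := by
    simp [fromBlocks_multiply]
  rwa [heq, irreducible_isUnit_mul hP, irreducible_mul_isUnit hQ] at h'

end Linearization

section EndomorphismAlgebra

open Module

variable {k : Type*} [Field k] [IsAlgClosed k] {V : Type*} [AddCommGroup V] [Module k V]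
  [FiniteDimensional k V]

lemma Module.End.exists_hasEigenvalue_ne_zero {T : End k V} (hT : ¬IsNilpotent T) :
    ∃ μ, μ ≠ 0 ∧ T.HasEigenvalue μ := by
  by_contra! h
  refine hT ?_
  have h1 : ∀ μ, μ ≠ 0 → T.maxGenEigenspace μ = ⊥ := by
    intro μ hμ
    by_contra h2
    have h3 := T.maxGenEigenspace_eq μ
    rw [h3] at h2
    exact h μ hμ (Module.End.hasEigenvalue_of_hasGenEigenvalue h2)
  have h2 := Module.End.iSup_maxGenEigenspace_eq_top T
  have h3 : T.maxGenEigenspace 0 = ⊤ := by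
    rw [← top_le_iff, ← h2]
    refine iSup_le fun μ => ?_
    by_cases hμ : μ = 0
    · rw [hμ]
    · rw [h1 μ hμ]
      exact bot_le
  rw [T.maxGenEigenspace_eq 0] at h3
  refine ⟨T.maxGenEigenspaceIndex 0, LinearMap.ext fun v => ?_⟩
  have h4 : v ∈ T.genEigenspace 0 (T.maxGenEigenspaceIndex 0) := h3 ▸ Submodule.mem_top
  simpa [Module.End.mem_genEigenspace_nat] using h4

/-- A subalgebra of endomorphisms that is not nil either contains an endomorphism with
one-dimensional eigenspace at `1`, or has an invariant subspace such that some element of the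
algebra is nilpotent neither on the subspace nor on the quotient. -/
theorem Submodule.exists_finrank_ker_eq_one_or_exists_invariant (S : Submodule k (End k V))
    (hmul : ∀ a ∈ S, ∀ b ∈ S, a * b ∈ S) (hS : ∃ T ∈ S, ¬IsNilpotent T) :
    (∃ T ∈ S, finrank k (LinearMap.ker (1 - T)) = 1) ∨
      ∃ T ∈ S, ∃ W : Submodule k V, (∀ a ∈ S, ∀ w ∈ W, a w ∈ W) ∧
        (∀ n : ℕ, ∃ w ∈ W, (T ^ n) w ≠ 0) ∧ ∀ n : ℕ, ∃ v, (T ^ n) v ∉ W := by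
  obtain ⟨T, ⟨hTS, hT⟩, hmin⟩ := exists_minimalFor_of_wellFoundedLT
    (fun T : End k V => T ∈ S ∧ ¬IsNilpotent T) (fun T => finrank k (LinearMap.range T)) hS
  replace hmin : ∀ b ∈ S, finrank k (LinearMap.range b) < finrank k (LinearMap.range T) →
      IsNilpotent b := fun b hb hlt => by
    by_contra hnil
    exact absurd (hmin ⟨hb, hnil⟩ hlt.le) (not_le.2 hlt)
  set Y := LinearMap.range T with hY
  have hTY : ∀ v, T v ∈ Y := fun v => ⟨v, rfl⟩
  have hsq : Y.map T = Y := by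
    have h1 : LinearMap.range (T * T) = Y.map T := LinearMap.range_comp T T
    refine Submodule.eq_of_le_of_finrank_le (by rintro _ ⟨v, _, rfl⟩; exact hTY v) ?_
    by_contra! hlt
    rw [← h1] at hlt
    obtain ⟨n, hn⟩ := hmin _ (hmul T hTS T hTS) hlt
    exact hT ⟨2 * n, by rw [pow_mul, sq, hn]⟩
  have hsurj : ∀ y ∈ Y, ∃ y' ∈ Y, T y' = y := fun y hy => by
    rw [← hsq] at hy
    exact hy
  have hinj : ∀ y ∈ Y, T y = 0 → y = 0 := by
    have h1 : Function.Surjective (T.restrict (p := Y) (q := Y) fun v _ => hTY v) := by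
      rintro ⟨y, hy⟩
      obtain ⟨y', hy', h⟩ := hsurj y hy
      exact ⟨⟨y', hy'⟩, Subtype.ext h⟩
    have h2 := LinearMap.injective_iff_surjective.2 h1
    intro y hy h
    exact congrArg Subtype.val (@h2 ⟨y, hy⟩ 0 (Subtype.ext (by simpa using h)))
  have hpow_mem : ∀ (n : ℕ), ∀ y ∈ Y, ∃ y' ∈ Y, (T ^ n) y' = y := by
    intro n
    induction n with
    | zero => exact fun y hy => ⟨y, hy, rfl⟩
    | succ n ih =>
      intro y hy
      obtain ⟨y', hy', rfl⟩ := hsurj y hy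
      obtain ⟨z, hz, rfl⟩ := ih y' hy'
      exact ⟨z, hz, by rw [pow_succ']; rfl⟩
  have hpow_ne : ∀ (n : ℕ), ∀ y ∈ Y, y ≠ 0 → (T ^ n) y ≠ 0 := by
    intro n
    induction n with
    | zero => exact fun y _ h => h
    | succ n ih =>
      intro y hy h0
      rw [pow_succ]
      exact ih _ (hTY y) (mt (hinj y hy) h0)
  by_cases hcase : ∃ u ∈ Y, u ≠ 0 ∧ ∃ y ∈ Y, ∀ a ∈ S, T (a u) ≠ y
  · obtain ⟨u, hu, hu0, y, hy, hay⟩ := hcase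
    refine Or.inr ⟨T, hTS, S.map (LinearMap.applyₗ u), ?_, fun n => ?_, fun n => ?_⟩
    · rintro a ha _ ⟨b, hb, rfl⟩
      exact ⟨a * b, hmul a ha b hb, rfl⟩
    · exact ⟨T u, ⟨T, hTS, rfl⟩, by simpa [pow_succ] using hpow_ne (n + 1) u hu hu0⟩
    · obtain ⟨y', hy', rfl⟩ := hsurj y hy
      obtain ⟨z, -, rfl⟩ := hpow_mem n y' hy'
      refine ⟨z, ?_⟩
      rintro ⟨a, ha, h⟩
      exact hay a ha (congrArg T h)
  push Not at hcase
  left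
  have hY0 : ∃ u ∈ Y, u ≠ 0 := by
    by_contra! h
    exact hT ⟨1, LinearMap.ext fun v => by simpa using h _ (hTY v)⟩
  obtain ⟨u, hu, hu0⟩ := hY0
  have hscal : ∀ b ∈ S, ∃ c : k, ∀ y ∈ Y, T (b y) = c • y := by
    intro b hb
    have : Nontrivial Y := ⟨⟨u, hu⟩, 0, fun h => hu0 (congrArg Subtype.val h)⟩
    obtain ⟨c, hc⟩ := Module.End.exists_eigenvalue
      ((T * b).restrict (p := Y) (q := Y) fun v _ => hTY (b v))
    obtain ⟨⟨e, heY⟩, he⟩ := hc.exists_hasEigenvector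
    have he1 : T (b e) = c • e := congrArg Subtype.val he.apply_eq_smul
    have he0 : e ≠ 0 := fun h => he.2 (Subtype.ext h)
    refine ⟨c, ?_⟩
    by_contra! hne
    obtain ⟨y, hy, hyc⟩ := hne
    obtain ⟨z, hz, rfl⟩ := hsurj y hy
    set D : End k V := T * b - c • 1 with hD
    set d : End k V := T * b * T - c • T with hd
    have hdD : d = D * T := by rw [hd, hD, sub_mul, smul_mul_assoc, one_mul]
    have hdS : d ∈ S := S.sub_mem (hmul _ (hmul _ hTS _ hb) _ hTS) (S.smul_mem _ hTS)
    have hdz : d z ≠ 0 := sub_ne_zero.2 hyc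
    have hdY : ∀ v, d v ∈ Y := fun v => Y.sub_mem (hTY _) (Y.smul_mem _ (hTY _))
    obtain ⟨a, ha, haz⟩ := hcase (d z) (hdY z) hdz z hz
    have hrank : finrank k (LinearMap.range (T * a * d)) < finrank k Y := by
      have h1 : LinearMap.range (T * a * d) = (LinearMap.range d).map (T * a) :=
        LinearMap.range_comp _ _
      have h2 : LinearMap.range d = Y.map D := by rw [hdD]; exact LinearMap.range_comp _ _
      have h3 : finrank k (Y.map D) < finrank k Y := by
        have h4 := LinearMap.finrank_range_add_finrank_ker (D.domRestrict Y)
        rw [LinearMap.range_domRestrict] at h4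
        have h5 : 0 < finrank k (LinearMap.ker (D.domRestrict Y)) := by
          rw [finrank_pos_iff]
          refine ⟨⟨⟨e, heY⟩, ?_⟩, 0, fun h => he0 (congrArg (fun x => x.1.1) h)⟩
          simp [hD, he1]
        omega
      rw [h1, h2]
      exact (Submodule.finrank_map_le _ _).trans_lt h3
    obtain ⟨n, hn⟩ := hmin _ (hmul _ (hmul _ hTS _ ha) _ hdS) hrank
    have hfix : ∀ m : ℕ, ((T * a * d) ^ m) z = z := by
      intro m
      induction m with
      | zero => rfl
      | succ m ih => rw [pow_succ, Module.End.mul_apply]; exact (congrArg _ haz).trans ih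
    have := hfix n
    rw [hn] at this
    exact hdz (by rw [← this]; simp)
  have hspan : ∀ y ∈ Y, ∃ c : k, y = c • u := by
    intro y hy
    obtain ⟨a, ha, rfl⟩ := hcase u hu hu0 y hy
    obtain ⟨c, hc⟩ := hscal a ha
    exact ⟨c, hc u hu⟩
  obtain ⟨μ, hμ⟩ := hspan (T u) (hTY u)
  have hμ0 : μ ≠ 0 := by
    rintro rfl
    exact hu0 (hinj u hu (by simpa using hμ))
  refine ⟨μ⁻¹ • T, S.smul_mem _ hTS, ?_⟩
  have hker : LinearMap.ker (1 - μ⁻¹ • T) = Submodule.span k {u} := by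
    ext v
    rw [LinearMap.mem_ker, Submodule.mem_span_singleton, LinearMap.sub_apply, sub_eq_zero]
    constructor
    · intro h
      obtain ⟨c, hc⟩ := hspan v (h ▸ Y.smul_mem _ (hTY v) : (1 : End k V) v ∈ Y)
      exact ⟨c, hc.symm⟩
    · rintro ⟨c, rfl⟩
      simp [hμ, smul_smul, hμ0]
  rw [hker, finrank_span_singleton hu0]

end EndomorphismAlgebra

section Pencil

open Module FreeAlgebra

universe u v

variable {k : Type u} [Field k] {g : ℕ} (α : Fin g → k) {ι : Type v}

/-- The representation `x_j ↦ A_j + α_j` of the free algebra. -/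
def pencilRep (A : Fin g → End k (ι → k)) : FreeAlgebra k (Fin g) →ₐ[k] End k (ι → k) :=
  lift k fun j => A j + algebraMap k _ (α j)

variable (A : Fin g → End k (ι → k))

@[simp] lemma pencilRep_shift (j : Fin g) : pencilRep α A (shift α j) = A j := by
  simp [pencilRep, shift]

lemma pencilRep_apply (q : FreeAlgebra k (Fin g)) (v : ι → k) :
    pencilRep α A q v = lift k α q • v + ∑ j, A j (pencilRep α A (fox α j q) v) := by
  conv_lhs => rw [eq_add_sum_shift_mul_fox α q]
  simp [LinearMap.sum_apply]

/-- The image of the augmentation ideal at `α` under the representation of a pencil. -/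
def augImage : Submodule k (End k (ι → k)) :=
  (LinearMap.ker (lift k α).toLinearMap).map (pencilRep α A).toLinearMap

variable {α A} in
lemma mem_augImage {T : End k (ι → k)} :
    T ∈ augImage α A ↔ ∃ p, lift k α p = 0 ∧ pencilRep α A p = T := Iff.rfl

lemma mul_mem_augImage : ∀ a ∈ augImage α A, ∀ b ∈ augImage α A, a * b ∈ augImage α A := by
  rintro _ ⟨p, hp, rfl⟩ _ ⟨q, hq, rfl⟩
  exact ⟨p * q, by simp_all, by simp⟩

lemma coeff_mem_augImage (j : Fin g) : A j ∈ augImage α A := ⟨shift α j, by simp, by simp⟩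

variable {A} in
lemma pencilRep_mul_of_invariant {E F : End k (ι → k)} (hEF : E + F = 1)
    (hE : E * E = E) (h : ∀ j, F * A j * E = 0) (q : FreeAlgebra k (Fin g)) :
    E * pencilRep α A q * E = pencilRep α A q * E ∧
      pencilRep α (fun j => A j * E) q * E = pencilRep α A q * E := by
  have hA : ∀ j, E * A j * E = A j * E := fun j => by
    rw [← sub_eq_zero, ← neg_eq_zero, neg_sub, ← sub_mul, ← one_sub_mul, ← hEF,
      add_sub_cancel_left, h]
  induction q using FreeAlgebra.induction with
  | grade0 r => simp [Algebra.algebraMap_eq_smul_one, hE]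
  | grade1 j =>
    simp [pencilRep, Algebra.algebraMap_eq_smul_one, mul_add, add_mul, hA, hE, mul_assoc]
  | add a b ha hb => simp [mul_add, add_mul, ha, hb]
  | mul a b ha hb =>
    simp only [map_mul]
    constructor
    · rw [← mul_assoc, mul_assoc _ (pencilRep α A b), ← hb.1, ← mul_assoc, ← mul_assoc, ha.1]
      simp only [mul_assoc]
      rw [← mul_assoc E, hb.1]
    · rw [mul_assoc, hb.2, ← hb.1, ← mul_assoc, ← mul_assoc, ha.2]
      simp only [mul_assoc]
      rw [← mul_assoc E, hb.1]

variable {A} in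
lemma mul_pencilRep_of_invariant {E F : End k (ι → k)} (hEF : E + F = 1)
    (hF : F * F = F) (h : ∀ j, F * A j * E = 0) (q : FreeAlgebra k (Fin g)) :
    F * pencilRep α A q * F = F * pencilRep α A q ∧
      F * pencilRep α (fun j => A j * F) q = F * pencilRep α A q := by
  have hA : ∀ j, F * A j * F = F * A j := fun j => by
    have := h j
    rw [eq_sub_of_add_eq hEF, mul_sub, sub_eq_zero, mul_one] at this
    exact this.symm
  induction q using FreeAlgebra.induction with
  | grade0 r => simp [Algebra.algebraMap_eq_smul_one, hF]
  | grade1 j =>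
    simp [pencilRep, Algebra.algebraMap_eq_smul_one, mul_add, add_mul, hF, ← mul_assoc, hA]
  | add a b ha hb => simp [mul_add, add_mul, ha, hb]
  | mul a b ha hb =>
    simp only [map_mul]
    constructor
    · rw [← mul_assoc, ← ha.1, mul_assoc _ F, mul_assoc _ (F * _), hb.1]
    · rw [← mul_assoc, ha.2, ← ha.1, mul_assoc _ F, hb.2, ← mul_assoc, ← mul_assoc, ha.1]

variable [Fintype ι] [DecidableEq ι]

/-- The linear part `∑ A_j (x_j - α_j)` of the pencil at `α` with coefficients `A`. -/
def pencilPart : Matrix ι ι (FreeAlgebra k (Fin g)) :=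
  Matrix.of fun i l => ∑ j, (A j).toMatrix' i l • shift α j

/-- The monic pencil `1 - ∑ A_j (x_j - α_j)`. -/
def pencil : Matrix ι ι (FreeAlgebra k (Fin g)) :=
  1 - pencilPart α A

lemma toMatrix'_mul_apply_sum (a : End k (ι → k)) (v : ι → k) (i : ι) :
    ∑ l, a.toMatrix' i l * v l = a v i :=
  congrFun (LinearMap.toMatrix'_mulVec a v) i

variable {α} in
/-- Kernels of evaluated pencils realize all eigenspaces at `1` of the elements `p` of the
augmentation ideal at `α`. -/
theorem exists_finrank_ker_matAct_pencil {p : FreeAlgebra k (Fin g)} (hp : lift k α p = 0) :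
    ∃ (V : Type u) (_ : AddCommGroup V) (_ : Module k V) (_ : FiniteDimensional k V)
      (φ : FreeAlgebra k (Fin g) →ₐ[k] End k V), ∀ A : Fin g → End k (ι → k),
      finrank k (LinearMap.ker (matAct φ (pencil α A))) =
        finrank k (LinearMap.ker (1 - pencilRep α A p)) := by
  obtain ⟨n', hn'⟩ := exists_mem_degLT α p
  obtain ⟨n, hn1, hpn⟩ : ∃ n, 1 ≤ n ∧ p ∈ degLT α n :=
    ⟨n' + 1, by omega, degLT_mono α n'.le_succ hn'⟩
  have hfox : ∀ j, ∀ q ∈ degLT α n, fox α j q ∈ degLT α n := fun j q hq =>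
    degLT_mono α (Nat.sub_le n 1) (fox_mem_degLT α hq j)
  let τ : Fin g → End k (degLT α n) := fun j => LinearMap.restrict
    (fox α j + (lift k α).toLinearMap.smulRight (fox α j p)) fun q hq =>
      add_mem (hfox j q hq) (Submodule.smul_mem _ _ (hfox j p hpn))
  have hτ : ∀ j q, (τ j q : FreeAlgebra k (Fin g)) = fox α j q + lift k α q.1 • fox α j p :=
    fun j q => rfl
  let φ : FreeAlgebra k (Fin g) →ₐ[k] End k (degLT α n →ₗ[k] k) :=
    lift k fun j => LinearMap.lcomp k k (τ j) + algebraMap k _ (α j)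
  have hφ : ∀ j, φ (shift α j) = LinearMap.lcomp k k (τ j) := fun j => by
    rw [shift, map_sub, AlgHom.commutes, lift_ι_apply]
    exact add_sub_cancel_right (LinearMap.lcomp k k (τ j) : End k (degLT α n →ₗ[k] k)) _
  refine ⟨degLT α n →ₗ[k] k, _, _, inferInstance, φ, fun A => ?_⟩
  set o : degLT α n := ⟨1, one_mem_degLT α hn1⟩ with ho
  have hmem : ∀ v : ι → degLT α n →ₗ[k] k, v ∈ LinearMap.ker (matAct φ (pencil α A)) ↔
      ∀ q, (fun i => v i q) = ∑ j, A j (fun i => v i (τ j q)) := by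
    intro v
    have h1 : ∀ i q, (matAct φ (pencilPart α A) v) i q = ∑ j, A j (fun i => v i (τ j q)) i := by
      intro i q
      simp only [matAct_apply, pencilPart, Matrix.of_apply, map_sum, map_smul, hφ,
        LinearMap.sum_apply, LinearMap.smul_apply, LinearMap.lcomp_apply, smul_eq_mul]
      rw [Finset.sum_comm]
      exact Finset.sum_congr rfl fun j _ => toMatrix'_mul_apply_sum _ _ _
    rw [LinearMap.mem_ker, pencil, sub_eq_add_neg, matAct_add, matAct_neg, LinearMap.add_apply,
      matAct_one, LinearMap.neg_apply, ← sub_eq_add_neg, sub_eq_zero]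
    constructor
    · intro h q
      ext i
      rw [Finset.sum_apply, ← h1, ← h]
    · intro h
      ext i q
      rw [h1, ← Finset.sum_apply, ← h q]
  have hrep : ∀ v ∈ LinearMap.ker (matAct φ (pencil α A)), ∀ q : degLT α n,
      (fun i => v i q) = pencilRep α A q (fun i => v i o) := by
    intro v hv
    rw [hmem] at hv
    have h1 : ∀ q : degLT α n, (fun i => v i q) = lift k α q.1 • (fun i => v i o) +
        ∑ j, A j (fun i => v i ⟨fox α j q, hfox j q q.2⟩) := by
      intro q
      have h2 : ∀ j, τ j q = ⟨fox α j q, hfox j q q.2⟩ + lift k α q.1 • τ j o := fun j =>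
        Subtype.ext (by simp [hτ, ho])
      rw [hv q, hv o, Finset.smul_sum, ← Finset.sum_add_distrib]
      refine Finset.sum_congr rfl fun j _ => ?_
      have h3 : (fun i => v i (⟨fox α j q, hfox j q q.2⟩ + lift k α q.1 • τ j o)) =
          (fun i => v i ⟨fox α j q, hfox j q q.2⟩) + lift k α q.1 • fun i => v i (τ j o) := by
        ext i
        simp
      rw [h2, h3, map_add, map_smul, add_comm]
    have h3 : ∀ m, ∀ q : degLT α n, q.1 ∈ degLT α m →
        (fun i => v i q) = pencilRep α A q (fun i => v i o) := by
      intro m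
      induction m with
      | zero =>
        intro q hq
        obtain rfl : q = 0 := Subtype.ext hq
        ext i
        simp
      | succ m ih =>
        intro q hq
        rw [h1, pencilRep_apply]
        congr 1
        refine Finset.sum_congr rfl fun j _ => ?_
        rw [ih ⟨_, _⟩ ((mem_degLT_succ α).1 hq j)]
    exact fun q => h3 n q q.2
  let e : LinearMap.ker (matAct φ (pencil α A)) →ₗ[k] LinearMap.ker (1 - pencilRep α A p) :=
    LinearMap.restrict (LinearMap.pi fun i => LinearMap.applyₗ o ∘ₗ LinearMap.proj i) fun v hv => by
      have h1 := hrep v hv ⟨p, hpn⟩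
      have h2 := (hmem v).1 hv
      have h3 : (fun i => v i ⟨p, hpn⟩) = fun i => v i o := by
        rw [h2, h2 o]
        refine Finset.sum_congr rfl fun j _ => ?_
        rw [show τ j ⟨p, hpn⟩ = τ j o from Subtype.ext (by simp [hτ, ho, hp])]
      rw [LinearMap.mem_ker, LinearMap.sub_apply, sub_eq_zero]
      exact h3.symm.trans h1
  refine (LinearEquiv.ofBijective e ⟨?_, ?_⟩).finrank_eq
  · rintro ⟨v, hv⟩ ⟨v', hv'⟩ h0
    have h1 : (fun i => v i o) = fun i => v' i o := congrArg Subtype.val h0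
    refine Subtype.ext (funext fun i => LinearMap.ext fun q => ?_)
    have h2 := hrep v hv q
    rw [h1, ← hrep v' hv'] at h2
    exact congrFun h2 i
  · rintro ⟨w, hw⟩
    have hw' : pencilRep α A p w = w := by
      rw [LinearMap.mem_ker, LinearMap.sub_apply, sub_eq_zero] at hw
      exact hw.symm
    let v : ι → degLT α n →ₗ[k] k := fun i => LinearMap.proj i ∘ₗ LinearMap.applyₗ w ∘ₗ
      (pencilRep α A).toLinearMap ∘ₗ Submodule.subtype _
    have hv : ∀ q, (fun i => v i q) = pencilRep α A q w := fun q => rfl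
    refine ⟨⟨v, (hmem v).2 fun q => ?_⟩, Subtype.ext ?_⟩
    · simp only [hv, hτ, map_add, map_smul, LinearMap.add_apply, LinearMap.smul_apply,
        Finset.sum_add_distrib, ← Finset.smul_sum]
      have h4 := pencilRep_apply α A p w
      rw [hp, zero_smul, zero_add, hw'] at h4
      rw [pencilRep_apply, ← h4, add_comm]
    · change pencilRep α A (1 : FreeAlgebra k (Fin g)) w = w
      simp

variable {α A} in
/-- If a pencil is invertible, then the corresponding representation of the augmentation ideal
is nil. -/
lemma isNilpotent_pencilRep_of_isUnit [IsAlgClosed k] (hA : IsUnit (pencil α A))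
    {p : FreeAlgebra k (Fin g)} (hp : lift k α p = 0) : IsNilpotent (pencilRep α A p) := by
  by_contra hnil
  obtain ⟨μ, hμ, hev⟩ := End.exists_hasEigenvalue_ne_zero hnil
  obtain ⟨v, hv⟩ := hev.exists_hasEigenvector
  obtain ⟨V, _, _, _, φ, hφ⟩ := exists_finrank_ker_matAct_pencil (ι := ι)
    (p := μ⁻¹ • p) (α := α) (by simp [hp])
  have h := hφ A
  rw [ker_matAct_eq_bot_of_isUnit φ hA, finrank_bot, eq_comm, Submodule.finrank_eq_zero] at h
  refine hv.2 ((Submodule.mem_bot k).1 (h ▸ ?_))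
  rw [LinearMap.mem_ker, LinearMap.sub_apply, map_smul, LinearMap.smul_apply,
    hv.apply_eq_smul, smul_smul, inv_mul_cancel₀ hμ]
  simp

variable {α A} in
/-- If the representation of the augmentation ideal is nil, then the pencil is invertible. -/
lemma exists_not_isNilpotent_of_not_isUnit (hA : ¬IsUnit (pencil α A)) :
    ∃ T ∈ augImage α A, ¬IsNilpotent T := by
  set N := pencilPart α A with hN
  let cst : (ι → k) → ι → FreeAlgebra k (Fin g) := fun w i => algebraMap k _ (w i)
  have hNw : ∀ w, N *ᵥ cst w = ∑ j, fun i => cst (A j w) i * shift α j := by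
    intro w
    ext i
    simp only [hN, pencilPart, mulVec, dotProduct, Matrix.of_apply, cst, Finset.sum_apply,
      Finset.sum_mul]
    rw [Finset.sum_comm]
    refine Finset.sum_congr rfl fun j _ => ?_
    rw [← toMatrix'_mul_apply_sum, map_sum, Finset.sum_mul]
    refine Finset.sum_congr rfl fun l _ => ?_
    rw [← Algebra.commutes, ← Algebra.smul_def, ← Algebra.smul_def, smul_smul, mul_comm]
  let K : Set (ι → k) := {w | ∃ m, (N ^ m) *ᵥ cst w = 0}
  have hmono : ∀ m m' w, m ≤ m' → (N ^ m) *ᵥ cst w = 0 → (N ^ m') *ᵥ cst w = 0 := by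
    intro m m' w hm h
    obtain ⟨r, rfl⟩ := Nat.exists_eq_add_of_le' hm
    rw [pow_add, ← mulVec_mulVec, h, mulVec_zero]
  have hK : ∀ w, (∀ j, A j w ∈ K) → w ∈ K := by
    intro w hw
    choose m hm using hw
    refine ⟨Finset.univ.sup m + 1, ?_⟩
    rw [pow_succ, ← mulVec_mulVec, hNw, mulVec_sum]
    refine Finset.sum_eq_zero fun j _ => ?_
    have h1 := hmono _ _ _ (Finset.le_sup (f := m) (Finset.mem_univ j)) (hm j)
    ext i
    have h2 := congrFun h1 i
    simp only [mulVec, dotProduct, ← mul_assoc, ← Finset.sum_mul] at h2 ⊢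
    rw [h2]
    simp
  have hne : ∃ w, w ∉ K := by
    by_contra! h
    choose m hm using fun l : ι => h (Pi.single l 1)
    refine hA (IsNilpotent.isUnit_one_sub ⟨Finset.univ.sup m, ?_⟩)
    ext i l
    have h1 := congrFun (hmono _ _ _ (Finset.le_sup (f := m) (Finset.mem_univ l)) (hm l)) i
    have h2 : cst (Pi.single l 1) = Pi.single l 1 := by
      ext i
      by_cases hi : i = l
      · subst hi
        simp [cst]
      · simp [cst, hi]
    rw [h2, mulVec_single_one] at h1
    exact h1
  obtain ⟨s, hsK, hs⟩ := exists_minimalFor_of_wellFoundedLT (fun w => w ∉ K)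
    (fun w => finrank k ((augImage α A).map (LinearMap.applyₗ w))) hne
  obtain ⟨j, hj⟩ := not_forall.1 (mt (hK s) hsK)
  have hle : (augImage α A).map (LinearMap.applyₗ (A j s)) ≤
      (augImage α A).map (LinearMap.applyₗ s) := by
    rintro _ ⟨a, ha, rfl⟩
    exact ⟨a * A j, mul_mem_augImage α A a ha _ (coeff_mem_augImage α A j), rfl⟩
  have heq := Submodule.eq_of_le_of_finrank_le hle
    (hs hj (Submodule.finrank_mono hle))
  have hmem : A j s ∈ (augImage α A).map (LinearMap.applyₗ (A j s)) :=
    heq ▸ ⟨A j, coeff_mem_augImage α A j, rfl⟩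
  obtain ⟨T, hT, hTs⟩ := hmem
  refine ⟨T, hT, fun ⟨n, hn⟩ => hj ?_⟩
  have hfix : ∀ m : ℕ, (T ^ m) (A j s) = A j s := by
    intro m
    induction m with
    | zero => rfl
    | succ m ih => rw [pow_succ, Module.End.mul_apply]; exact (congrArg _ hTs).trans ih
  rw [← hfix n, hn]
  exact ⟨0, by ext i; simp [cst]⟩

lemma pencilPart_mul (F : End k (ι → k)) :
    pencilPart α (fun j => A j * F) = pencilPart α A * F.toMatrix'.map (algebraMap k _) := by
  ext i l
  simp only [pencilPart, Matrix.mul_apply, Matrix.of_apply, Matrix.map_apply, Finset.sum_mul,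
    Module.End.mul_eq_comp, LinearMap.toMatrix'_comp, Finset.sum_smul]
  rw [Finset.sum_comm]
  refine Finset.sum_congr rfl fun j _ => Finset.sum_congr rfl fun m _ => ?_
  rw [← Algebra.commutes, ← Algebra.smul_def, smul_smul, mul_comm]

lemma mul_pencilPart (F : End k (ι → k)) :
    pencilPart α (fun j => F * A j) = F.toMatrix'.map (algebraMap k _) * pencilPart α A := by
  ext i l
  simp only [pencilPart, Matrix.mul_apply, Matrix.of_apply, Matrix.map_apply, Finset.mul_sum,
    Module.End.mul_eq_comp, LinearMap.toMatrix'_comp, Finset.sum_smul]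
  rw [Finset.sum_comm]
  refine Finset.sum_congr rfl fun j _ => Finset.sum_congr rfl fun m _ => ?_
  rw [← Algebra.smul_def, smul_smul]

variable {A} in
/-- A block triangular pencil factors. -/
lemma pencil_eq_mul {E F : End k (ι → k)} (hEF : E + F = 1) (h : ∀ j, F * A j * E = 0) :
    pencil α A = pencil α (fun j => A j * F) * pencil α (fun j => A j * E) := by
  have h0 : pencilPart α (fun j => A j * F) * pencilPart α (fun j => A j * E) = 0 := by
    rw [pencilPart_mul, Matrix.mul_assoc, ← mul_pencilPart]
    simp only [← mul_assoc, h]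
    ext i l
    simp [pencilPart, Matrix.mul_apply]
  have h1 : pencilPart α A =
      pencilPart α (fun j => A j * F) + pencilPart α (fun j => A j * E) := by
    have h2 : ∀ j, A j = A j * F + A j * E := fun j => by
      rw [← mul_add, add_comm, hEF, mul_one]
    ext i l
    simp only [pencilPart, Matrix.add_apply, Matrix.of_apply, ← Finset.sum_add_distrib, ← add_smul]
    refine Finset.sum_congr rfl fun j _ => ?_
    conv_lhs => rw [h2 j]
    simp
  rw [pencil, pencil, pencil, sub_mul, mul_sub, mul_sub, h0, h1]
  simp only [mul_one, one_mul]
  abel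

variable {α A} in
/-- An irreducible pencil over an algebraically closed field has a one-dimensional kernel at some
matrix point. -/
theorem hasOneDimKernel_pencil [IsAlgClosed k] (hA : Irreducible (pencil α A)) :
    HasOneDimKernel (pencil α A) := by
  rcases (augImage α A).exists_finrank_ker_eq_one_or_exists_invariant (mul_mem_augImage α A)
    (exists_not_isNilpotent_of_not_isUnit hA.not_isUnit) with ⟨T, hT, h1⟩ | ⟨T, hT, W, hW, hT1, hT2⟩
  · obtain ⟨p, hp, rfl⟩ := mem_augImage.1 hT
    obtain ⟨V, i1, i2, i3, φ, hφ⟩ := exists_finrank_ker_matAct_pencil (ι := ι) hp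
    exact ⟨V, i1, i2, i3, φ, (hφ A).trans h1⟩
  · exfalso
    obtain ⟨p, hp, rfl⟩ := mem_augImage.1 hT
    obtain ⟨π, hπ⟩ := W.subtype.exists_leftInverse_of_injective W.ker_subtype
    set E : End k (ι → k) := W.subtype ∘ₗ π with hE
    have hEW : ∀ w ∈ W, E w = w := fun w hw =>
      congrArg Subtype.val (LinearMap.congr_fun hπ (⟨w, hw⟩ : W))
    have hEmem : ∀ v, E v ∈ W := fun v => (π v).2
    have hEE : E * E = E := LinearMap.ext fun v => hEW _ (hEmem v)
    have hEF : E + (1 - E) = 1 := add_sub_cancel _ _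
    have hFF : (1 - E) * (1 - E) = 1 - E := by
      rw [mul_sub, mul_one, sub_mul, one_mul, hEE, sub_self, sub_zero]
    have hFA : ∀ j, (1 - E) * A j * E = 0 := fun j => LinearMap.ext fun v => by
      simp [hEW _ (hW _ (coeff_mem_augImage α A j) _ (hEmem v))]
    rcases hA.isUnit_or_isUnit (pencil_eq_mul α hEF hFA) with hu | hu
    · obtain ⟨n, hn⟩ := isNilpotent_pencilRep_of_isUnit hu hp
      obtain ⟨v, hv⟩ := hT2 n
      have h1 := (mul_pencilRep_of_invariant α hEF hFF hFA (p ^ n)).2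
      rw [map_pow, map_pow, hn, mul_zero] at h1
      have h2 := LinearMap.congr_fun h1 v
      simp only [LinearMap.zero_apply, Module.End.mul_apply, LinearMap.sub_apply,
        Module.End.one_apply] at h2
      exact hv (sub_eq_zero.1 h2.symm ▸ hEmem _)
    · obtain ⟨n, hn⟩ := isNilpotent_pencilRep_of_isUnit hu hp
      obtain ⟨w, hwW, hw⟩ := hT1 n
      have h1 := (pencilRep_mul_of_invariant α hEF hEE hFA (p ^ n)).2
      rw [map_pow, map_pow, hn, zero_mul] at h1
      refine hw ?_
      rw [← hEW w hwW]
      exact (LinearMap.congr_fun h1 w).symm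

end Pencil

section Reduction

open FreeAlgebra

variable {k : Type*} [Field k] [IsAlgClosed k] {g : ℕ} {α : Fin g → k}

lemma hasOneDimKernel_of_mem_degLT_two {ι : Type*} [Fintype ι] [DecidableEq ι]
    {f : Matrix ι ι (FreeAlgebra k (Fin g))} (hdeg : ∀ i l, f i l ∈ degLT α 2)
    (hf : Irreducible f) (hα : IsUnit (f.map (lift k α))) : HasOneDimKernel f := by
  obtain ⟨c, hc⟩ := hα
  let B : Fin g → Matrix ι ι k := fun j => Matrix.of fun i l => lift k α (fox α j (f i l))
  let A : Fin g → Module.End k (ι → k) := fun j => toLin' (-(c⁻¹.1 * B j))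
  have hu : IsUnit ((algebraMap k (FreeAlgebra k (Fin g))).mapMatrix c.1) := c.isUnit.map _
  have hcA : (fun j => toLin' c.1 * A j) = fun j => toLin' (-B j) := by
    ext1 j
    rw [Module.End.mul_eq_comp, ← toLin'_mul, Matrix.mul_neg, c.mul_inv_cancel_left]
  have hfA : f = (algebraMap k (FreeAlgebra k (Fin g))).mapMatrix c.1 * pencil α A := by
    have h1 := mul_pencilPart α A (toLin' c.1)
    rw [hcA] at h1
    rw [pencil, mul_sub, mul_one, RingHom.mapMatrix_apply, ← LinearMap.toMatrix'_toLin' c.1, ← h1,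
      LinearMap.toMatrix'_toLin']
    ext1 i l
    have h2 := eq_add_sum_shift_mul_fox α (f i l)
    have h3 : ∀ j, shift α j * fox α j (f i l) = B j i l • shift α j := fun j => by
      rw [eq_algebraMap_of_mem_degLT_one α ((mem_degLT_succ α).1 (hdeg i l) j),
        ← Algebra.commutes, ← Algebra.smul_def]
      simp [B]
    simp only [h3] at h2
    rw [h2, hc]
    simp [pencilPart]
  obtain ⟨u, hu'⟩ := hu
  refine HasOneDimKernel.of_isUnit_mul (u⁻¹).isUnit ?_
  rw [← hu'] at hfA
  have h4 : pencil α A = (u⁻¹).1 * f := by rw [hfA, u.inv_mul_cancel_left]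
  rw [← h4]
  rw [hfA, irreducible_units_mul] at hf
  exact hasOneDimKernel_pencil hf

/-- An irreducible matrix over the free algebra that is invertible at a scalar point has a
one-dimensional kernel in some finite-dimensional representation. -/
theorem Irreducible.hasOneDimKernel {ι : Type} [Fintype ι] [DecidableEq ι]
    {f : Matrix ι ι (FreeAlgebra k (Fin g))} (hf : Irreducible f)
    (hα : IsUnit (f.map (lift k α))) : HasOneDimKernel f := by
  obtain ⟨n, hn⟩ : ∃ n, ∀ i l, f i l ∈ degLT α (n + 2) := by
    choose m hm using fun p : ι × ι => exists_mem_degLT α (f p.1 p.2)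
    exact ⟨Finset.univ.sup m, fun i l => degLT_mono α
      ((Finset.le_sup (f := m) (Finset.mem_univ (i, l))).trans (Nat.le_add_right _ _)) (hm (i, l))⟩
  induction n generalizing ι with
  | zero => exact hasOneDimKernel_of_mem_degLT_two hn hf hα
  | succ n ih =>
    let c : Matrix ι ι (FreeAlgebra k (Fin g)) := (f.map (lift k α)).map (algebraMap k _)
    let y : Matrix ι (Fin g × ι) (FreeAlgebra k (Fin g)) :=
      Matrix.of fun i p => if i = p.2 then shift α p.1 else 0
    let z : Matrix (Fin g × ι) ι (FreeAlgebra k (Fin g)) :=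
      Matrix.of fun p l => fox α p.1 (f p.2 l)
    have hfc : f = c + y * z := by
      ext1 i l
      rw [eq_add_sum_shift_mul_fox α (f i l)]
      simp [c, y, z, Matrix.mul_apply, Fintype.sum_prod_type]
    rw [hfc] at hf
    have hε : IsUnit ((fromBlocks c (-y) z 1).map (lift k α)) := by
      have h1 : (fromBlocks c (-y) z 1).map (lift k α) =
          fromBlocks (f.map (lift k α)) 0 (z.map (lift k α)) 1 := by
        rw [fromBlocks_map]
        congr 1
        · ext i l
          simp [c]
        · ext i l
          simp only [y, Matrix.map_apply, Matrix.neg_apply, Matrix.of_apply, map_neg]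
          split_ifs <;> simp
        · exact Matrix.map_one _ (map_zero _) (map_one _)
      rw [h1]
      exact isUnit_fromBlocks_one_iff.2 hα
    have hdeg : ∀ i l, fromBlocks c (-y) z 1 i l ∈ degLT α (n + 2) := by
      rintro (i | p) (l | q)
      · exact algebraMap_mem_degLT α (by omega) _
      · refine neg_mem ?_
        simp only [y, Matrix.of_apply]
        split_ifs
        · exact degLT_mono α (by omega) (shift_mem_degLT α _)
        · exact zero_mem _
      · exact (mem_degLT_succ α).1 (hn p.2 l) p.1
      · simp only [fromBlocks_apply₂₂, Matrix.one_apply]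
        split_ifs
        · exact one_mem_degLT α (by omega)
        · exact zero_mem _
    obtain ⟨V, i1, i2, i3, φ, hφ⟩ := ih hf.linearization hε hdeg
    rw [hfc]
    exact ⟨V, i1, i2, i3, φ, (finrank_ker_matAct_linearization φ c y z).symm.trans hφ⟩

end Reduction

/-- If `f ∈ M_d(k⟨x⟩)` is an atom that is invertible at some scalar point, then there is a
matrix tuple `X` such that `ker f(X)` is one-dimensional. -/
theorem atom_exists_one_dimensional_kernel
    {k : Type*} [Field k] [IsAlgClosed k] [CharZero k] {g d : ℕ}
    (f : Matrix (Fin d) (Fin d) (FreeAlgebra k (Fin g)))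
    (hatom : MatAtom f)
    (α : Fin g → k) (hα : IsUnit (f.map ⇑(FreeAlgebra.lift k α))) :
    ∃ (n : ℕ) (X : Fin g → Matrix (Fin n) (Fin n) k),
      Module.finrank k (LinearMap.ker (matEval f X).mulVecLin) = 1 := by
  exact (Irreducible.hasOneDimKernel ⟨hatom.1, fun a b h => hatom.2 a b h⟩ hα).exists_matEval
end
end

section
/- Let k be an algebraically closed field of characteristic zero and let L = I_d − Σ_{j=1}^g A_j x_j be an FL-minimal monic linear pencil with L ≠ I_d. Then there exists n₀ ∈ ℕ such that for every n ≥ n₀ the polynomial det L(gX^(n)) ∈ k[ξ] is squarefree. -/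
open Matrix MvPolynomial

noncomputable section

/-- Evaluation of the monic linear pencil `L = I_d - ∑ j, A j * x j` at a `g`-tuple `X` of
`n × n` matrices over a commutative `k`-algebra `R`, via the Kronecker product. -/
def pencilEval {k : Type*} [CommRing k] {g d n : ℕ} {R : Type*} [CommRing R] [Algebra k R]
    (A : Fin g → Matrix (Fin d) (Fin d) k) (X : Fin g → Matrix (Fin n) (Fin n) R) :
    Matrix (Fin d × Fin n) (Fin d × Fin n) R :=
  1 - ∑ j, Matrix.kroneckerMap (· * ·) ((A j).map fun a => algebraMap k R a) (X j)

/-! ### Invertibility in finite-dimensional algebras -/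

theorem isUnit_map_iff_of_injective_of_finite {k R S : Type*} [Field k] [Ring R] [Algebra k R]
    [FiniteDimensional k R] [Ring S] (φ : R →+* S) (hφ : Function.Injective φ) {x : R} :
    IsUnit (φ x) ↔ IsUnit x := by
  refine ⟨fun h => ?_, fun h => h.map φ⟩
  have hinj : Function.Injective (LinearMap.mulLeft k x) := by
    intro a b hab
    apply hφ
    apply h.mul_left_cancel
    simpa using congrArg φ hab
  obtain ⟨y, hy⟩ := LinearMap.injective_iff_surjective.mp hinj 1
  have hxy : x * y = 1 := hy
  have hyx : y * x = 1 := by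
    apply hinj
    change x * (y * x) = x * 1
    rw [← mul_assoc, hxy, one_mul, mul_one]
  exact ⟨⟨x, y, hxy, hyx⟩, rfl⟩

theorem isUnit_of_mul_eq_one_of_finite (k : Type*) {R : Type*} [Field k] [Ring R] [Algebra k R]
    [FiniteDimensional k R] {x y : R} (h : y * x = 1) : IsUnit x := by
  have hinj : Function.Injective (LinearMap.mulLeft k x) := by
    intro a b hab
    have := congrArg (y * ·) hab
    simpa [← mul_assoc, h] using this
  obtain ⟨z, hz⟩ := LinearMap.injective_iff_surjective.mp hinj 1
  have hxz : x * z = 1 := hz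
  have hyz : y = z := by rw [← mul_one y, ← hxz, ← mul_assoc, h, one_mul]
  exact ⟨⟨x, z, hxz, hyz ▸ h⟩, rfl⟩

/-- A matrix over a finite-dimensional algebra is invertible as soon as it is invertible modulo
the Jacobson radical. -/
theorem Matrix.isUnit_of_isUnit_mapMatrix_of_ker_le_jacobson (k : Type*) {R S ι : Type*}
    [Field k] [Ring R] [Algebra k R] [FiniteDimensional k R] [Ring S] [Fintype ι] [DecidableEq ι]
    (φ : R →+* S) (hφ : Function.Surjective φ) (hker : RingHom.ker φ ≤ Ring.jacobson R)
    {M : Matrix ι ι R} (hM : IsUnit (φ.mapMatrix M)) : IsUnit M := by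
  obtain ⟨N, hN⟩ : ∃ N, N * φ.mapMatrix M = 1 := hM.exists_left_inv
  obtain ⟨N, rfl⟩ : ∃ N' : Matrix ι ι R, φ.mapMatrix N' = N :=
    ⟨N.map (Function.surjInv hφ), by ext; simp [Function.surjInv_eq hφ]⟩
  have hmem : N * M - 1 ∈ ((⊥ : Ideal R).matrix ι).jacobson := by
    apply Ideal.matrix_jacobson_le
    intro i j
    rw [Ring.jacobson_eq_sInf_isMaximal] at hker
    have hz : φ.mapMatrix (N * M - 1) = 0 := by rw [map_sub, map_mul, hN, map_one, sub_self]
    have := congrFun (congrFun hz i) j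
    have h2 : (N * M - 1) i j ∈ RingHom.ker φ := by simpa using this
    simpa [Ideal.jacobson] using hker h2
  obtain ⟨z, hz⟩ := Ideal.mem_jacobson_iff.mp hmem 1
  rw [Ideal.matrix_bot, Ideal.mem_bot] at hz
  refine isUnit_of_mul_eq_one_of_finite k (y := z * N) ?_
  have : z * N * M = z * 1 * (N * M - 1) + z := by noncomm_ring
  rw [this]; exact sub_eq_zero.mp hz

theorem Matrix.isUnit_pi_iff {ι κ : Type*} {R : κ → Type*} [∀ i, Ring (R i)] [Fintype ι]
    [DecidableEq ι] {M : Matrix ι ι (∀ i, R i)} :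
    IsUnit M ↔ ∀ i, IsUnit ((Pi.evalRingHom R i).mapMatrix M) := by
  rw [← MulEquiv.isUnit_map (Matrix.piRingEquiv (n := ι) (β := R)), Pi.isUnit_iff]
  rfl

/-- The image of a finite-dimensional algebra modulo its radical is a product of matrix
algebras. -/
theorem exists_algHom_pi_matrix_ker_le_jacobson (k R : Type*) [Field k] [IsAlgClosed k] [Ring R]
    [Algebra k R] [FiniteDimensional k R] :
    ∃ (m : ℕ) (e : Fin m → ℕ) (π : R →ₐ[k] ∀ i, Matrix (Fin (e i)) (Fin (e i)) k),
      Function.Surjective π ∧ RingHom.ker π ≤ Ring.jacobson R := by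
  have := IsArtinianRing.of_finite k R
  have : IsSemisimpleRing (R ⧸ Ring.jacobson R) := inferInstance
  obtain ⟨m, e, -, ⟨ψ⟩⟩ :=
    IsSemisimpleRing.exists_algEquiv_pi_matrix_of_isAlgClosed k (R ⧸ Ring.jacobson R)
  refine ⟨m, e, ψ.toAlgHom.comp (Ideal.Quotient.mkₐ k (Ring.jacobson R)), ?_, ?_⟩
  · exact ψ.surjective.comp Ideal.Quotient.mk_surjective
  · intro x hx
    have : ψ (Ideal.Quotient.mk (Ring.jacobson R) x) = 0 := hx
    rw [EmbeddingLike.map_eq_zero_iff] at this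
    exact Ideal.Quotient.eq_zero_iff_mem.mp this

/-! ### Pencils with coefficients in an algebra -/

/-- Evaluation at `X` of the monic linear pencil `1 - ∑ j, a j * x j` with coefficients in an
arbitrary algebra. -/
def algPencil {k R : Type*} [CommRing k] [Ring R] [Algebra k R] {g n : ℕ} (a : Fin g → R)
    (X : Fin g → Matrix (Fin n) (Fin n) k) : Matrix (Fin n) (Fin n) R :=
  1 - ∑ j, (X j).map (fun c => c • a j)

theorem map_algPencil {k R S : Type*} [CommRing k] [Ring R] [Algebra k R] [Ring S] [Algebra k S]
    {g n : ℕ} (a : Fin g → R) (X : Fin g → Matrix (Fin n) (Fin n) k) (ρ : R →ₐ[k] S) :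
    (ρ : R →+* S).mapMatrix (algPencil a X) = algPencil (fun j => ρ (a j)) X := by
  rw [algPencil, algPencil, map_sub, map_one, map_sum]
  congr 1
  refine Finset.sum_congr rfl fun j _ => ?_
  ext i i'
  simp

theorem pencilEval_apply {k : Type*} [CommRing k] {g d n : ℕ} {R : Type*} [CommRing R]
    [Algebra k R] (A : Fin g → Matrix (Fin d) (Fin d) k) (X : Fin g → Matrix (Fin n) (Fin n) R)
    (p q : Fin d × Fin n) :
    pencilEval A X p q = (1 : Matrix (Fin d × Fin n) (Fin d × Fin n) R) p q -
      ∑ j, algebraMap k R (A j p.1 q.1) * X j p.2 q.2 := by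
  simp [pencilEval, Matrix.sum_apply, Matrix.kroneckerMap_apply]

theorem isUnit_algPencil_matrix_iff {k : Type*} [Field k] {g d n : ℕ}
    (A : Fin g → Matrix (Fin d) (Fin d) k) (X : Fin g → Matrix (Fin n) (Fin n) k) :
    IsUnit (algPencil A X) ↔ (pencilEval A X).det ≠ 0 := by
  have h : pencilEval A X = Matrix.reindex (Equiv.prodComm _ _) (Equiv.prodComm _ _)
      (Matrix.compRingEquiv (Fin n) (Fin d) k (algPencil A X)) := by
    ext p q
    rw [pencilEval_apply]
    simp only [algPencil, Matrix.reindex_apply, Matrix.submatrix_apply, Equiv.prodComm_symm,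
      Equiv.prodComm_apply, Matrix.compRingEquiv_apply, Matrix.comp_apply, Matrix.sub_apply,
      Matrix.sum_apply, Matrix.map_apply, Matrix.smul_apply, smul_eq_mul, Prod.fst_swap,
      Prod.snd_swap, Algebra.algebraMap_self, RingHom.id_apply]
    congr 1
    · by_cases h2 : p.2 = q.2 <;> by_cases h1 : p.1 = q.1 <;>
        simp [Matrix.one_apply, Prod.ext_iff, h1, h2]
    · exact Finset.sum_congr rfl fun j _ => mul_comm _ _
  rw [h, Matrix.det_reindex_self, ← isUnit_iff_ne_zero, ← Matrix.isUnit_iff_isUnit_det,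
    MulEquiv.isUnit_map]

/-- Invertibility of a pencil can be tested after embedding its coefficients into matrices. -/
theorem isUnit_algPencil_iff_of_injective {k R : Type*} [Field k] [Ring R] [Algebra k R]
    [FiniteDimensional k R] {g d n : ℕ} (a : Fin g → R)
    (X : Fin g → Matrix (Fin n) (Fin n) k) (ρ : R →ₐ[k] Matrix (Fin d) (Fin d) k)
    (hρ : Function.Injective ρ) :
    IsUnit (algPencil a X) ↔ (pencilEval (fun j => ρ (a j)) X).det ≠ 0 := by
  rw [← isUnit_algPencil_matrix_iff, ← map_algPencil,
    isUnit_map_iff_of_injective_of_finite (k := k)]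
  intro M N h
  ext i j
  exact hρ (congrFun (congrFun h i) j)

/-- A finite product of matrix algebras embeds into one matrix algebra, of the sum of their
sizes. -/
theorem exists_injective_algHom_pi_matrix (k : Type*) [CommRing k] {κ : Type*} [Fintype κ]
    (e : κ → ℕ) :
    ∃ ρ : (∀ i, Matrix (Fin (e i)) (Fin (e i)) k) →ₐ[k]
      Matrix (Fin (∑ i, e i)) (Fin (∑ i, e i)) k, Function.Injective ρ := by
  classical
  let β : (∀ i, Matrix (Fin (e i)) (Fin (e i)) k) →ₐ[k]
      Matrix (Σ i, Fin (e i)) (Σ i, Fin (e i)) k :=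
    { Matrix.blockDiagonal'RingHom (fun i => Fin (e i)) k with
      commutes' := fun c => by
        ext ⟨i, x⟩ ⟨j, y⟩
        by_cases h : i = j
        · subst h
          simp [Matrix.blockDiagonal'_apply, Matrix.algebraMap_matrix_apply]
        · simp [Matrix.blockDiagonal'_apply, Matrix.algebraMap_matrix_apply, h] }
  have hc : Fintype.card (Σ i, Fin (e i)) = Fintype.card (Fin (∑ i, e i)) := by simp
  refine ⟨(Matrix.reindexAlgEquiv k k (Fintype.equivOfCardEq hc)).toAlgHom.comp β, ?_⟩
  exact (Matrix.reindexAlgEquiv k k (Fintype.equivOfCardEq hc)).injective.comp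
    Matrix.blockDiagonal'_injective

/-- Restricting a surjection with radical kernel onto a product of matrix algebras to the factors
on which the coefficients do not all vanish does not affect invertibility of pencils. -/
theorem isUnit_algPencil_iff_restrict {k R : Type*} [Field k] [Ring R] [Algebra k R]
    [FiniteDimensional k R] {g n m : ℕ} (a : Fin g → R) (X : Fin g → Matrix (Fin n) (Fin n) k)
    {e : Fin m → ℕ} (π : R →ₐ[k] ∀ i, Matrix (Fin (e i)) (Fin (e i)) k)
    (hπ : Function.Surjective π) (hker : RingHom.ker π ≤ Ring.jacobson R) :
    IsUnit (algPencil (fun j (i : {i // ∃ j, π (a j) i ≠ 0}) => π (a j) i) X) ↔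
      IsUnit (algPencil a X) := by
  have h1 : IsUnit (algPencil a X) ↔ IsUnit (algPencil (fun j => π (a j)) X) := by
    rw [← map_algPencil]
    exact ⟨fun h => h.map _, Matrix.isUnit_of_isUnit_mapMatrix_of_ker_le_jacobson k
      (π : R →+* ∀ i, Matrix (Fin (e i)) (Fin (e i)) k) hπ hker⟩
  have h2 : ∀ i, (Pi.evalRingHom (fun i => Matrix (Fin (e i)) (Fin (e i)) k) i).mapMatrix
      (algPencil (fun j => π (a j)) X) = algPencil (fun j => π (a j) i) X := fun i =>
    map_algPencil _ _ (Pi.evalAlgHom k (fun i => Matrix (Fin (e i)) (Fin (e i)) k) i)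
  have h3 : ∀ i : {i // ∃ j, π (a j) i ≠ 0},
      (Pi.evalRingHom (fun i : {i // ∃ j, π (a j) i ≠ 0} =>
        Matrix (Fin (e i)) (Fin (e i)) k) i).mapMatrix
      (algPencil (fun j (i : {i // ∃ j, π (a j) i ≠ 0}) => π (a j) i) X) =
        algPencil (fun j => π (a j) i) X := fun i =>
    map_algPencil _ _ (Pi.evalAlgHom k (fun i : {i // ∃ j, π (a j) i ≠ 0} =>
        Matrix (Fin (e i)) (Fin (e i)) k) i)
  rw [h1, Matrix.isUnit_pi_iff, Matrix.isUnit_pi_iff]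
  simp only [h2, h3]
  refine ⟨fun h i => ?_, fun h i => h i⟩
  by_cases hi : ∃ j, π (a j) i ≠ 0
  · exact h ⟨i, hi⟩
  · push Not at hi
    have : algPencil (fun j => π (a j) i) X = 1 := by
      ext; simp [algPencil, hi, Matrix.sum_apply]
    rw [this]; exact isUnit_one

/-! ### The ideal generated by the coefficients of a pencil -/

/-- An enumeration of all the products of the elements `a j`. -/
def wordProd {R : Type*} [Ring R] {g : ℕ} (a : Fin g → R) : ℕ → R
  | 0 => 1
  | t + 1 => if h : 0 < g then a ⟨t % g, Nat.mod_lt t h⟩ * wordProd a (t / g) else 0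
  decreasing_by exact Nat.lt_succ_of_le (Nat.div_le_self t g)

theorem wordProd_zero {R : Type*} [Ring R] {g : ℕ} (a : Fin g → R) : wordProd a 0 = 1 := by
  rw [wordProd]

theorem wordProd_cons {R : Type*} [Ring R] {g : ℕ} (a : Fin g → R) (j : Fin g) (i : ℕ) :
    wordProd a (g * i + j + 1) = a j * wordProd a i := by
  have hg : 0 < g := j.pos
  rw [wordProd, dif_pos hg]
  have h1 : (g * i + j) % g = j := by rw [Nat.mul_add_mod, Nat.mod_eq_of_lt j.2]
  have h2 : (g * i + j) / g = i := by
    rw [Nat.mul_add_div hg, Nat.div_eq_of_lt j.2, add_zero]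
  simp only [h1, h2]

/-- The span of all nonempty words in the elements `a j`. -/
def wordIdeal (k : Type*) {R : Type*} [Field k] [Ring R] [Algebra k R] {g : ℕ} (a : Fin g → R) :
    Submodule k R :=
  Submodule.span k (Set.range fun p : Fin g × ℕ => a p.1 * wordProd a p.2)

section wordIdeal

variable {k R : Type*} [Field k] [Ring R] [Algebra k R] {g : ℕ} (a : Fin g → R)

theorem mem_wordIdeal (j : Fin g) : a j ∈ wordIdeal k a :=
  Submodule.subset_span ⟨(j, 0), by simp [wordProd_zero]⟩

theorem mul_mem_wordIdeal {x y : R} (hx : x ∈ Algebra.adjoin k (Set.range a))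
    (hy : y ∈ wordIdeal k a) : x * y ∈ wordIdeal k a := by
  induction hx using Algebra.adjoin_induction generalizing y with
  | mem x hx =>
    obtain ⟨j, rfl⟩ := hx
    induction hy using Submodule.span_induction with
    | mem y hy =>
      obtain ⟨⟨j', i⟩, rfl⟩ := hy
      exact Submodule.subset_span ⟨(j, g * i + j' + 1), by simp [wordProd_cons]⟩
    | zero => simp
    | add y z _ _ hy hz => rw [mul_add]; exact add_mem hy hz
    | smul c y _ hy => rw [mul_smul_comm]; exact Submodule.smul_mem _ _ hy
  | algebraMap c => rw [← Algebra.smul_def]; exact Submodule.smul_mem _ _ hy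
  | add x z _ _ hx hz => rw [add_mul]; exact add_mem (hx hy) (hz hy)
  | mul x z _ _ hx hz => rw [mul_assoc]; exact hx (hz hy)

theorem wordProd_mul_mem_wordIdeal (i : ℕ) (l : Fin g) :
    wordProd a i * a l ∈ wordIdeal k a := by
  induction i using Nat.strong_induction_on with
  | _ i ih =>
    rcases i with _ | t
    · simpa [wordProd_zero] using mem_wordIdeal a l
    · rw [wordProd, dif_pos l.pos, mul_assoc]
      exact mul_mem_wordIdeal a (Algebra.subset_adjoin ⟨_, rfl⟩)
        (ih _ (Nat.lt_succ_of_le (Nat.div_le_self t g)))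

theorem mem_wordIdeal_mul {x y : R} (hx : x ∈ Algebra.adjoin k (Set.range a))
    (hy : y ∈ wordIdeal k a) : y * x ∈ wordIdeal k a := by
  induction hx using Algebra.adjoin_induction generalizing y with
  | mem x hx =>
    obtain ⟨l, rfl⟩ := hx
    induction hy using Submodule.span_induction with
    | mem y hy =>
      obtain ⟨⟨j', i⟩, rfl⟩ := hy
      rw [mul_assoc]
      exact mul_mem_wordIdeal a (Algebra.subset_adjoin ⟨_, rfl⟩)
        (wordProd_mul_mem_wordIdeal a i l)
    | zero => simp
    | add y z _ _ hy hz => rw [add_mul]; exact add_mem hy hz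
    | smul c y _ hy => rw [smul_mul_assoc]; exact Submodule.smul_mem _ _ hy
  | algebraMap c =>
    rw [← Algebra.commutes, ← Algebra.smul_def]; exact Submodule.smul_mem _ _ hy
  | add x z _ _ hx hz => rw [mul_add]; exact add_mem (hx hy) (hz hy)
  | mul x z _ _ hx hz => rw [← mul_assoc]; exact hz (hx hy)

theorem exists_sum_of_mem_wordIdeal {b : R} (hb : b ∈ wordIdeal k a) :
    ∃ (N : ℕ) (z : Fin g → ℕ → k), ∀ n ≥ N,
      b = ∑ j, ∑ i : Fin n, z j i • (a j * wordProd a i) := by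
  suffices ∃ (N : ℕ) (z : Fin g → ℕ → k), (∀ j, ∀ i ≥ N, z j i = 0) ∧
      b = ∑ j, ∑ i ∈ Finset.range N, z j i • (a j * wordProd a i) by
    obtain ⟨N, z, hz, hb⟩ := this
    refine ⟨N, z, fun n hn => ?_⟩
    rw [hb]
    refine Finset.sum_congr rfl fun j _ => ?_
    rw [Fin.sum_univ_eq_sum_range (fun i => z j i • (a j * wordProd a i))]
    refine Finset.sum_subset (Finset.range_mono hn) fun i _ hi => ?_
    rw [hz j i (by simpa using hi), zero_smul]
  obtain ⟨c, rfl⟩ := (Finsupp.mem_span_range_iff_exists_finsupp).mp hb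
  classical
  refine ⟨(c.support.image Prod.snd).sup id + 1, fun j i => c (j, i), fun j i hi => ?_, ?_⟩
  · by_contra h
    have : i ≤ (c.support.image Prod.snd).sup id :=
      Finset.le_sup (f := id) (Finset.mem_image.mpr ⟨(j, i), by simpa using h, rfl⟩)
    omega
  · rw [Finsupp.sum, ← Finset.sum_product']
    refine Finset.sum_subset (fun p hp => ?_) fun p _ hp => ?_
    · have : p.2 ≤ (c.support.image Prod.snd).sup id :=
        Finset.le_sup (f := id) (Finset.mem_image.mpr ⟨p, hp, rfl⟩)
      simpa using Nat.lt_succ_of_le this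
    · rw [Finsupp.notMem_support_iff.mp hp, zero_smul]

end wordIdeal

/-- Every tuple of diagonal matrices on the nontrivial factors is hit by the ideal generated by the
coefficients. -/
theorem exists_mem_wordIdeal_map_eq_diagonal {k R : Type*} [Field k] [Ring R] [Algebra k R]
    {g m : ℕ} (a : Fin g → R) {e : Fin m → ℕ}
    (π : Algebra.adjoin k (Set.range a) →ₐ[k] ∀ i, Matrix (Fin (e i)) (Fin (e i)) k)
    (hπ : Function.Surjective π)
    (lam : ∀ i, Fin (e i) → k) :
    ∃ b : Algebra.adjoin k (Set.range a), (b : R) ∈ wordIdeal k a ∧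
      ∀ i, (∃ j, π ⟨a j, Algebra.subset_adjoin ⟨j, rfl⟩⟩ i ≠ 0) →
        π b i = Matrix.diagonal (lam i) := by
  classical
  let I : Submodule k (Algebra.adjoin k (Set.range a)) :=
    (wordIdeal k a).comap (Algebra.adjoin k (Set.range a)).val.toLinearMap
  let J := I.map π.toLinearMap
  have hI : ∀ x y z, y ∈ I → x * y * z ∈ I := fun x y z hy =>
    mem_wordIdeal_mul a z.2 (mul_mem_wordIdeal a x.2 hy)
  have hJ : ∀ x y z, y ∈ J → x * y * z ∈ J := by
    rintro x _ z ⟨y, hy, rfl⟩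
    obtain ⟨x, rfl⟩ := hπ x
    obtain ⟨z, rfl⟩ := hπ z
    exact ⟨x * y * z, hI x y z hy, by simp⟩
  have key : ∀ i, (∃ j, π ⟨a j, Algebra.subset_adjoin ⟨j, rfl⟩⟩ i ≠ 0) →
      Pi.single i (Matrix.diagonal (lam i)) ∈ J := by
    rintro i ⟨j, hj⟩
    set M := π ⟨a j, Algebra.subset_adjoin ⟨j, rfl⟩⟩ with hM
    have hMJ : M ∈ J := ⟨_, mem_wordIdeal a j, rfl⟩
    obtain ⟨p, q, hpq⟩ : ∃ p q, M i p q ≠ 0 := by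
      by_contra! h
      exact hj (by ext p q; exact h p q)
    have hsum : Pi.single i (Matrix.diagonal (lam i)) = ∑ t, (lam i t * (M i p q)⁻¹) •
        (Pi.single i (Matrix.single t p 1) * M * Pi.single i (Matrix.single q t 1)) := by
      funext i'
      by_cases h : i' = i
      · subst h
        simp only [Pi.single_eq_same, Finset.sum_apply, Pi.smul_apply, Pi.mul_apply,
          Matrix.single_mul_mul_single, Matrix.smul_single, one_mul, mul_one, smul_eq_mul,
          inv_mul_cancel_right₀ hpq]
        exact (Matrix.sum_single_eq_diagonal _).symm
      · simp [h]
    rw [hsum]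
    exact sum_mem fun t _ => Submodule.smul_mem _ _ (hJ _ _ _ hMJ)
  have hmem : ∑ i with ∃ j, π ⟨a j, Algebra.subset_adjoin ⟨j, rfl⟩⟩ i ≠ 0,
      Pi.single i (Matrix.diagonal (lam i)) ∈ J :=
    sum_mem fun i hi => key i (by simpa using hi)
  obtain ⟨b, hb, hbe⟩ := hmem
  refine ⟨b, hb, fun i hi => ?_⟩
  have := congrFun hbe i
  rw [Finset.sum_apply] at this
  refine (this : π b i = _).trans ?_
  rw [Finset.sum_eq_single_of_mem i (by simpa using hi)]
  · simp
  · intro i' _ hne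
    simp [hne.symm]

/-- The coefficients of an FL-minimal pencil of size `d` generate an ideal with an element having
(at least) `d` distinct nonzero eigenvalues; we list their inverses. -/
theorem exists_mem_wordIdeal_det_eq_zero
    {k : Type*} [Field k] [IsAlgClosed k] [CharZero k] {g d : ℕ}
    (A : Fin g → Matrix (Fin d) (Fin d) k)
    (hmin : ∀ (d' : ℕ) (A' : Fin g → Matrix (Fin d') (Fin d') k),
      (∀ (n : ℕ) (X : Fin g → Matrix (Fin n) (Fin n) k),
        (pencilEval A' X).det = 0 ↔ (pencilEval A X).det = 0) → d ≤ d') :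
    ∃ b ∈ wordIdeal k A, ∃ s : Finset k, d ≤ s.card ∧ ∀ c ∈ s, (1 - c • b).det = 0 := by
  classical
  let S := Algebra.adjoin k (Set.range A)
  let a : Fin g → S := fun j => ⟨A j, Algebra.subset_adjoin ⟨j, rfl⟩⟩
  obtain ⟨m, e, π, hπ, hker⟩ := exists_algHom_pi_matrix_ker_le_jacobson k S
  let κ := {i // ∃ j, π (a j) i ≠ 0}
  obtain ⟨ρ, hρ⟩ := exists_injective_algHom_pi_matrix k (fun i : κ => e i)
  have hd : d ≤ ∑ i : κ, e i := by
    refine hmin _ (fun j => ρ fun i => π (a j) i) fun n X => ?_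
    rw [← not_iff_not, ← ne_eq, ← ne_eq]
    rw [← isUnit_algPencil_iff_of_injective (fun j (i : κ) => π (a j) i) X ρ hρ,
      isUnit_algPencil_iff_restrict a X π hπ hker,
      isUnit_algPencil_iff_of_injective a X S.val Subtype.val_injective]
    rfl
  let ν : (Σ i : κ, Fin (e i)) ≃ Fin (Fintype.card (Σ i : κ, Fin (e i))) :=
    Fintype.equivFin _
  let lam : ∀ i, Fin (e i) → k := fun i t =>
    if h : ∃ j, π (a j) i ≠ 0 then ((ν ⟨⟨i, h⟩, t⟩ : ℕ) + 1 : k) else 0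
  obtain ⟨b, hb, hbπ⟩ := exists_mem_wordIdeal_map_eq_diagonal A π hπ lam
  refine ⟨b, hb, Finset.univ.image fun p : Σ i : κ, Fin (e i) => ((ν p : ℕ) + 1 : k)⁻¹, ?_, ?_⟩
  · rw [Finset.card_image_of_injective]
    · simpa using hd
    · intro p q hpq
      have h1 := inv_injective hpq
      have h2 : (ν p : ℕ) = ν q := by exact_mod_cast add_right_cancel h1
      exact ν.injective (Fin.ext h2)
  · intro c hc
    obtain ⟨⟨⟨i, hi⟩, t⟩, -, rfl⟩ := Finset.mem_image.mp hc
    set c : k := ((ν ⟨⟨i, hi⟩, t⟩ : ℕ) + 1 : k) with hcdef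
    have hc0 : c ≠ 0 := Nat.cast_add_one_ne_zero _
    by_contra hdet
    have hu : IsUnit (1 - c⁻¹ • (b : Matrix (Fin d) (Fin d) k)) :=
      (Matrix.isUnit_iff_isUnit_det _).mpr (isUnit_iff_ne_zero.mpr hdet)
    have hu' : IsUnit (1 - c⁻¹ • b) := by
      rw [← isUnit_map_iff_of_injective_of_finite (k := k) (S.val : S →+* Matrix (Fin d) (Fin d) k)
        Subtype.val_injective]
      simpa using hu
    have hu2 := (hu'.map π).map (Pi.evalRingHom (fun i => Matrix (Fin (e i)) (Fin (e i)) k) i)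
    have hcl : lam i t = c := by simp only [lam, dif_pos hi, hcdef]
    have h3 : Pi.evalRingHom (fun i => Matrix (Fin (e i)) (Fin (e i)) k) i (π (1 - c⁻¹ • b)) =
        Matrix.diagonal (fun t => 1 - c⁻¹ * lam i t) := by
      simp only [map_sub, map_one, map_smul, Pi.evalRingHom_apply, Pi.smul_apply]
      rw [hbπ i hi, ← Matrix.diagonal_one, ← Matrix.diagonal_smul, Matrix.diagonal_sub]
      rfl
    rw [h3, Matrix.isUnit_iff_isUnit_det, Matrix.det_diagonal, isUnit_iff_ne_zero,
      Finset.prod_ne_zero_iff] at hu2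
    exact hu2 t (Finset.mem_univ _) (by rw [hcl, inv_mul_cancel₀ hc0, sub_self])

/-! ### Slices of generic matrices -/

theorem map_det_pencilEval {k R S : Type*} [CommRing k] [CommRing R] [Algebra k R] [CommRing S]
    [Algebra k S] {g d n : ℕ} (A : Fin g → Matrix (Fin d) (Fin d) k)
    (X : Fin g → Matrix (Fin n) (Fin n) R) (φ : R →ₐ[k] S) :
    φ (pencilEval A X).det = (pencilEval A fun j => (X j).map φ).det := by
  rw [AlgHom.map_det]
  congr 1
  ext p q
  simp only [AlgHom.mapMatrix_apply, Matrix.map_apply, pencilEval_apply, map_sub, map_sum,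
    map_mul, AlgHom.commutes]
  congr 1
  by_cases h : p = q <;> simp [Matrix.one_apply, h]

theorem pencilEval_mulVec {k : Type*} [CommRing k] {g d n : ℕ}
    (A : Fin g → Matrix (Fin d) (Fin d) k) (X : Fin g → Matrix (Fin n) (Fin n) k)
    (W : Fin n → Fin d → k) (i : Fin d) (ι : Fin n) :
    (pencilEval A X *ᵥ fun p => W p.2 p.1) (i, ι) =
      (W ι - ∑ j, ∑ κ, X j ι κ • (A j *ᵥ W κ)) i := by
  simp only [Matrix.mulVec, dotProduct, pencilEval_apply, sub_mul, Finset.sum_sub_distrib,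
    Pi.sub_apply, Finset.sum_apply, Pi.smul_apply, smul_eq_mul, Finset.sum_mul, Finset.mul_sum,
    Fintype.sum_prod_type, Algebra.algebraMap_self, RingHom.id_apply]
  congr 1
  · simp [Matrix.one_apply, Prod.ext_iff, ite_and]
  · rw [Finset.sum_congr rfl fun x _ => Finset.sum_comm, Finset.sum_comm]
    refine Finset.sum_congr rfl fun j _ => ?_
    rw [Finset.sum_comm]
    exact Finset.sum_congr rfl fun κ _ => Finset.sum_congr rfl fun x _ => by ring

/-- The specialization of the generic matrices whose `a`-th rows are `z` and whose remaining rows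
encode the recursion satisfied by `wordProd`. -/
def wordSlice {k : Type*} [CommRing k] {g n : ℕ} (e : Fin n ≃ Fin n) (a : Fin n)
    (z : Fin g → ℕ → k) (j : Fin g) : Matrix (Fin n) (Fin n) k :=
  Matrix.of fun ι κ => if ι = a then z j (e κ) else if (e ι : ℕ) = g * e κ + j + 1 then 1 else 0

section wordSlice

variable {k : Type*} [Field k] {g d n : ℕ} (A : Fin g → Matrix (Fin d) (Fin d) k)
  {e : Fin n ≃ Fin n} {a : Fin n} (z : Fin g → ℕ → k)

theorem wordSlice_sum_of_ne (ha : (e a : ℕ) = 0) {ι : Fin n} (hι : ι ≠ a) (hg : 0 < g) :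
    ∃ (j₀ : Fin g) (κ₀ : Fin n), (e ι : ℕ) = g * e κ₀ + j₀ + 1 ∧
      ∀ W : Fin n → Fin d → k,
        ∑ j, ∑ κ, wordSlice e a z j ι κ • (A j *ᵥ W κ) = A j₀ *ᵥ W κ₀ := by
  obtain ⟨t, ht⟩ : ∃ t, (e ι : ℕ) = t + 1 := Nat.exists_eq_succ_of_ne_zero fun h =>
    hι (e.injective (Fin.ext (h.trans ha.symm)))
  have htn : t / g < n := lt_of_le_of_lt (Nat.div_le_self t g) (by have := (e ι).2; omega)
  have hrec : (e ι : ℕ) = g * e (e.symm ⟨t / g, htn⟩) + t % g + 1 := by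
    rw [Equiv.apply_symm_apply, ht, Nat.div_add_mod]
  have huniq : ∀ (j : Fin g) (κ : Fin n), (e ι : ℕ) = g * e κ + j + 1 →
      j = ⟨t % g, Nat.mod_lt t hg⟩ ∧ κ = e.symm ⟨t / g, htn⟩ := by
    intro j κ h
    have h' : t = g * e κ + j := by omega
    constructor
    · ext
      change (j : ℕ) = t % g
      rw [h', Nat.mul_add_mod, Nat.mod_eq_of_lt j.2]
    · rw [Equiv.eq_symm_apply]
      ext
      change (e κ : ℕ) = t / g
      rw [h', Nat.mul_add_div hg, Nat.div_eq_of_lt j.2, add_zero]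
  refine ⟨⟨t % g, Nat.mod_lt t hg⟩, e.symm ⟨t / g, htn⟩, hrec, fun W => ?_⟩
  rw [Finset.sum_eq_single ⟨t % g, Nat.mod_lt t hg⟩, Finset.sum_eq_single (e.symm ⟨t / g, htn⟩)]
  · rw [wordSlice, Matrix.of_apply, if_neg hι, if_pos hrec, one_smul]
  · intro κ _ hκ
    rw [wordSlice, Matrix.of_apply, if_neg hι, if_neg fun h => hκ (huniq _ _ h).2, zero_smul]
  · simp
  · intro j _ hj
    refine Finset.sum_eq_zero fun κ _ => ?_
    rw [wordSlice, Matrix.of_apply, if_neg hι, if_neg fun h => hj (huniq _ _ h).1, zero_smul]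
  · simp

theorem det_pencilEval_wordSlice_eq_zero (ha : (e a : ℕ) = 0) (hg : 0 < g)
    (h : (1 - ∑ j, ∑ i : Fin n, z j i • (A j * wordProd A i)).det = 0) :
    (pencilEval A (wordSlice e a z)).det = 0 := by
  obtain ⟨v, hv0, hv⟩ := Matrix.exists_mulVec_eq_zero_iff.mpr h
  let W : Fin n → Fin d → k := fun κ => wordProd A (e κ) *ᵥ v
  have hWa : W a = v := by simp [W, ha, wordProd_zero]
  refine Matrix.exists_mulVec_eq_zero_iff.mp ⟨fun p => W p.2 p.1, fun h0 => hv0 ?_, ?_⟩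
  · rw [← hWa]
    funext i
    exact congrFun h0 (i, a)
  · funext ⟨i, ι⟩
    rw [pencilEval_mulVec]
    by_cases hι : ι = a
    · subst hι
      have : ∑ j, ∑ κ, wordSlice e ι z j ι κ • (A j *ᵥ W κ) =
          (∑ j, ∑ i : Fin n, z j i • (A j * wordProd A i)) *ᵥ v := by
        rw [Matrix.sum_mulVec]
        refine Finset.sum_congr rfl fun j _ => ?_
        rw [Matrix.sum_mulVec]
        refine (Finset.sum_congr rfl fun κ _ => ?_).trans
          (e.sum_comp fun i : Fin n => (z j i • (A j * wordProd A i)) *ᵥ v)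
        simp [wordSlice, W, Matrix.smul_mulVec]
      rw [Matrix.sub_mulVec, Matrix.one_mulVec] at hv
      rw [this, hWa]
      exact congrFun hv i
    · obtain ⟨j₀, κ₀, hrec, hsum⟩ := wordSlice_sum_of_ne A z ha hι hg
      rw [hsum]
      simp [W, hrec, wordProd_cons]

theorem det_pencilEval_wordSlice_zero_ne_zero (ha : (e a : ℕ) = 0) (hg : 0 < g) :
    (pencilEval A (wordSlice e a fun _ _ => (0 : k))).det ≠ 0 := by
  intro hdet
  obtain ⟨w, hw0, hw⟩ := Matrix.exists_mulVec_eq_zero_iff.mpr hdet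
  let W : Fin n → Fin d → k := fun κ i => w (i, κ)
  have hW : ∀ ι, W ι = ∑ j, ∑ κ, wordSlice e a (fun _ _ => (0 : k)) j ι κ • (A j *ᵥ W κ) := by
    intro ι
    rw [← sub_eq_zero]
    funext i
    rw [← pencilEval_mulVec]
    exact congrFun hw (i, ι)
  have hzero : ∀ (N : ℕ) (ι : Fin n), (e ι : ℕ) = N → W ι = 0 := by
    intro N
    induction N using Nat.strong_induction_on with
    | _ N ih =>
      intro ι hN
      by_cases hι : ι = a
      · subst hι
        rw [hW]
        simp [wordSlice]
      · obtain ⟨j₀, κ₀, hrec, hsum⟩ := wordSlice_sum_of_ne A (fun _ _ => (0 : k)) ha hι hg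
        have hlt : (e κ₀ : ℕ) < N := by
          have := Nat.le_mul_of_pos_left (e κ₀ : ℕ) hg
          omega
        rw [hW, hsum, ih _ hlt κ₀ rfl, Matrix.mulVec_zero]
  exact hw0 (funext fun p => congrFun (hzero _ p.2 rfl) p.1)

end wordSlice

/-! ### Degrees in one row of variables -/

/-- Scale the variables in the `a`-th rows of the generic matrices by a new variable. -/
def rowScale (k : Type*) [CommRing k] (g : ℕ) {n : ℕ} (a : Fin n) :
    MvPolynomial (Fin g × Fin n × Fin n) k →ₐ[k]
      Polynomial (MvPolynomial (Fin g × Fin n × Fin n) k) :=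
  MvPolynomial.aeval fun v =>
    if v.2.1 = a then Polynomial.C (MvPolynomial.X v) * Polynomial.X
    else Polynomial.C (MvPolynomial.X v)

section rowScale

variable {k : Type*} [Field k] {g n : ℕ}

theorem eval_rowScale (a : Fin n) (p : MvPolynomial (Fin g × Fin n × Fin n) k)
    (x : Fin g × Fin n × Fin n → k) (c : k) :
    ((rowScale k g a p).map (MvPolynomial.eval x)).eval c =
      MvPolynomial.eval (fun v => if v.2.1 = a then x v * c else x v) p := by
  have : ((Polynomial.evalRingHom c).comp (Polynomial.mapRingHom (MvPolynomial.eval x))).comp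
      (rowScale k g a : _ →+* _) =
      MvPolynomial.eval (fun v => if v.2.1 = a then x v * c else x v) := by
    refine MvPolynomial.ringHom_ext (fun r => ?_) fun v => ?_
    · have : (rowScale k g a) (MvPolynomial.C r) = Polynomial.C (MvPolynomial.C r) :=
        (rowScale k g a).commutes r
      simp [this]
    · by_cases h : v.2.1 = a <;> simp [rowScale, h]
  exact RingHom.congr_fun this p

theorem natDegree_rowScale_det_le {d : ℕ} (A : Fin g → Matrix (Fin d) (Fin d) k) (a : Fin n) :
    (rowScale k g a (pencilEval A (genX k g n)).det).natDegree ≤ d := by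
  rw [map_det_pencilEval, Matrix.det_apply]
  refine Polynomial.natDegree_sum_le_of_forall_le _ _ fun σ _ => ?_
  rw [Units.smul_def, ← Int.cast_smul_eq_zsmul (MvPolynomial (Fin g × Fin n × Fin n) k)]
  refine (Polynomial.natDegree_smul_le _ _).trans ((Polynomial.natDegree_prod_le _ _).trans ?_)
  have hentry : ∀ p q, (pencilEval A (fun j => (genX k g n j).map (rowScale k g a))
      q p).natDegree ≤ if q.2 = a then 1 else 0 := by
    intro p q
    rw [pencilEval_apply]
    refine (Polynomial.natDegree_sub_le _ _).trans (max_le ?_ ?_)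
    · by_cases h : q = p <;> simp [Matrix.one_apply, h]
    · refine Polynomial.natDegree_sum_le_of_forall_le _ _ fun j _ => ?_
      rw [← Algebra.smul_def, Algebra.smul_def, IsScalarTower.algebraMap_apply k
        (MvPolynomial (Fin g × Fin n × Fin n) k), Polynomial.algebraMap_eq]
      refine (Polynomial.natDegree_C_mul_le _ _).trans ?_
      by_cases h : q.2 = a <;> simp [genX, rowScale, h]
  calc _ ≤ ∑ p : Fin d × Fin n, if (σ p).2 = a then 1 else 0 :=
        Finset.sum_le_sum fun p _ => hentry _ _
    _ = ∑ p : Fin d × Fin n, if p.2 = a then 1 else 0 :=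
        Equiv.sum_comp σ fun p => if p.2 = a then 1 else 0
    _ ≤ d := by
        rw [Fintype.sum_prod_type]
        simp

theorem exists_eq_C_of_natDegree_rowScale_eq_zero [Infinite k]
    (p : MvPolynomial (Fin g × Fin n × Fin n) k)
    (h : ∀ a, (rowScale k g a p).natDegree = 0) : ∃ c, p = MvPolynomial.C c := by
  classical
  have hrow : ∀ a x, MvPolynomial.eval x p =
      MvPolynomial.eval (fun v => if v.2.1 = a then 0 else x v) p := by
    intro a x
    have h1 := eval_rowScale a p x 1
    have h0 := eval_rowScale a p x 0
    rw [Polynomial.eq_C_of_natDegree_eq_zero (h a), Polynomial.map_C, Polynomial.eval_C] at h1 h0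
    simpa using h1.symm.trans h0
  have hall : ∀ (s : Finset (Fin n)) (x : _), MvPolynomial.eval x p =
      MvPolynomial.eval (fun v => if v.2.1 ∈ s then 0 else x v) p := by
    intro s
    induction s using Finset.induction_on with
    | empty => simp
    | insert a s _ ih =>
      intro x
      rw [ih x, hrow a]
      congr 2
      funext v
      by_cases h1 : v.2.1 = a <;> by_cases h2 : v.2.1 ∈ s <;> simp [h1, h2]
  refine ⟨MvPolynomial.eval 0 p, MvPolynomial.funext fun x => ?_⟩
  rw [hall Finset.univ x, MvPolynomial.eval_C]
  congr 2
  funext v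
  simp

end rowScale

/-- If `L ≠ I` is an FL-minimal monic pencil, then `det L(gX⁽ⁿ⁾)` is squarefree for all
sufficiently large `n`. -/
theorem det_genericMatrices_squarefree_of_flMinimal
    {k : Type*} [Field k] [IsAlgClosed k] [CharZero k] {g d : ℕ}
    (A : Fin g → Matrix (Fin d) (Fin d) k) (hA : A ≠ 0)
    (hmin : ∀ (d' : ℕ) (A' : Fin g → Matrix (Fin d') (Fin d') k),
      (∀ (n : ℕ) (X : Fin g → Matrix (Fin n) (Fin n) k),
        (pencilEval A' X).det = 0 ↔ (pencilEval A X).det = 0) → d ≤ d') :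
    ∃ n₀ : ℕ, ∀ n ≥ n₀, Squarefree (pencilEval A (genX k g n)).det := by
  have hg : 0 < g := by
    rcases Nat.eq_zero_or_pos g with rfl | h
    · exact absurd (Subsingleton.elim _ _) hA
    · exact h
  obtain ⟨b, hb, s, hs, hroot⟩ := exists_mem_wordIdeal_det_eq_zero A hmin
  obtain ⟨N, z, hbz⟩ := exists_sum_of_mem_wordIdeal A hb
  refine ⟨N, fun n hn x hx => ?_⟩
  by_contra hunit
  set f := (pencilEval A (genX k g n)).det with hf
  have hfeval : ∀ y : Fin g × Fin n × Fin n → k, MvPolynomial.eval y f =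
      (pencilEval A fun j => Matrix.of fun ι κ => y (j, ι, κ)).det := by
    intro y
    rw [← MvPolynomial.coe_aeval_eq_eval, RingHom.coe_coe, hf, map_det_pencilEval]
    congr 2
    funext j
    ext ι κ
    simp [genX]
  have hf0 : f ≠ 0 := by
    intro h
    have := hfeval 0
    rw [h, map_zero] at this
    have h1 : (pencilEval A fun j => Matrix.of fun ι κ : Fin n =>
        (0 : Fin g × Fin n × Fin n → k) (j, ι, κ)) = 1 := by
      ext p q
      simp [pencilEval_apply]
    rw [h1, Matrix.det_one] at this
    exact zero_ne_one this
  obtain ⟨h, hxh⟩ := hx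
  have hx0 : x ≠ 0 := by
    rintro rfl
    exact hf0 (by rw [hxh, zero_mul, zero_mul])
  have hh0 : h ≠ 0 := by
    rintro rfl
    exact hf0 (by rw [hxh, mul_zero])
  obtain ⟨a, ha⟩ : ∃ a, (rowScale k g a x).natDegree ≠ 0 := by
    by_contra! hdeg
    obtain ⟨c, rfl⟩ := exists_eq_C_of_natDegree_rowScale_eq_zero x hdeg
    refine hunit ((isUnit_iff_ne_zero.mpr ?_).map MvPolynomial.C)
    rintro rfl
    exact hx0 (map_zero _)
  have hn0 : 0 < n := a.pos
  let e : Fin n ≃ Fin n := Equiv.swap a ⟨0, hn0⟩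
  have he : (e a : ℕ) = 0 := by simp [e]
  let y : Fin g × Fin n × Fin n → k := fun v => wordSlice e a z v.1 v.2.1 v.2.2
  have hslice : ∀ c, ((rowScale k g a f).map (MvPolynomial.eval y)).eval c =
      (pencilEval A (wordSlice e a fun j i => z j i * c)).det := by
    intro c
    rw [eval_rowScale, hfeval]
    congr 2
    funext j
    ext ι κ
    by_cases hι : ι = a <;> simp [y, wordSlice, hι]
  have hinj : ∀ p : MvPolynomial (Fin g × Fin n × Fin n) k, p ≠ 0 → rowScale k g a p ≠ 0 := by
    intro p hp hp0
    refine hp (MvPolynomial.funext fun u => ?_)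
    have := eval_rowScale a p u 1
    rw [hp0] at this
    simpa using this.symm
  have hdegf : 2 * (rowScale k g a x).natDegree + (rowScale k g a h).natDegree ≤ d := by
    have := natDegree_rowScale_det_le (n := n) A a
    rw [← hf, hxh, map_mul, map_mul, Polynomial.natDegree_mul
      (mul_ne_zero (hinj x hx0) (hinj x hx0)) (hinj h hh0),
      Polynomial.natDegree_mul (hinj x hx0) (hinj x hx0)] at this
    omega
  have hmapf : (rowScale k g a f).map (MvPolynomial.eval y) =
      (rowScale k g a x).map (MvPolynomial.eval y) *
        (rowScale k g a x).map (MvPolynomial.eval y) *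
        (rowScale k g a h).map (MvPolynomial.eval y) := by
    rw [hxh, map_mul, map_mul, Polynomial.map_mul, Polynomial.map_mul]
  set P := (rowScale k g a x).map (MvPolynomial.eval y)
  set Q := (rowScale k g a h).map (MvPolynomial.eval y)
  have hPQ : P * Q ≠ 0 := by
    intro h0
    have h1 := hslice 0
    rw [hmapf, mul_assoc, h0, mul_zero, Polynomial.eval_zero] at h1
    simp only [mul_zero] at h1
    exact det_pencilEval_wordSlice_zero_ne_zero A he hg h1.symm
  have hcard : s.card ≤ (P * Q).natDegree := by
    refine Polynomial.card_le_degree_of_subset_roots fun c hc => ?_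
    rw [Polynomial.mem_roots hPQ, Polynomial.IsRoot]
    have h1 := hslice c
    rw [det_pencilEval_wordSlice_eq_zero A _ he hg, hmapf] at h1
    · simp only [Polynomial.eval_mul, mul_eq_zero] at h1 ⊢
      tauto
    · rw [← hroot c hc, hbz n hn]
      congr 2
      simp only [Finset.smul_sum, smul_smul, mul_comm]
  have h1 : (P * Q).natDegree ≤
      (rowScale k g a x).natDegree + (rowScale k g a h).natDegree :=
    Polynomial.natDegree_mul_le.trans
      (add_le_add Polynomial.natDegree_map_le Polynomial.natDegree_map_le)
  omega
end
end

section
/- Let k be an algebraically closed field of characteristic zero and let L = I_d − Σ_{j=1}^g A_j x_j be an FL-minimal monic linear pencil with L ≠ I_d. Then there exists n₀ ∈ ℕ such that for every n ≥ n₀ there exists X ∈ M_n(k)^g with det L(X) = 0 and dim_k ker( L(X)·L(X) ) = 1 (the zero eigenvalue of L(X) has algebraic multiplicity one; in particular dim_k ker L(X) = 1). -/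
open Matrix

noncomputable section

theorem Module.End.eq_top_of_forall_smulRight_mem {k U : Type*} [Field k] [AddCommGroup U]
    [Module k U] [FiniteDimensional k U] (S : Submodule k (Module.End k U))
    (h : ∀ (φ : U →ₗ[k] k) (x : U), φ.smulRight x ∈ S) : S = ⊤ := by
  refine eq_top_iff.2 fun a _ => ?_
  let b := Module.finBasis k U
  have : a = ∑ i, (b.coord i).smulRight (a (b i)) := by
    refine b.ext fun j => ?_
    simp [Finsupp.single_apply, ite_smul]
  rw [this]
  exact S.sum_mem fun i _ => h _ _

/-- Burnside's theorem on irreducible matrix algebras. -/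
theorem Subalgebra.eq_top_of_irreducible {k U : Type*} [Field k] [IsAlgClosed k] [AddCommGroup U]
    [Module k U] [FiniteDimensional k U] [Nontrivial U] (B : Subalgebra k (Module.End k U))
    (irr : ∀ W : Submodule k U, (∀ b ∈ B, ∀ w ∈ W, b w ∈ W) → W = ⊥ ∨ W = ⊤) : B = ⊤ := by
  have : IsSimpleModule B U := by
    refine { eq_bot_or_eq_top := fun W => ?_ }
    rcases irr (W.restrictScalars k) fun b hb w hw => W.smul_mem (⟨b, hb⟩ : B) hw with h | h
    · left; ext x; simpa using SetLike.ext_iff.1 h x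
    · right; ext x; simpa using SetLike.ext_iff.1 h x
  have hscal : ∀ φ : Module.End B U, ∃ c : k, ∀ x, φ x = c • x := by
    intro φ
    obtain ⟨c, hc⟩ := (IsSimpleModule.algebraMap_end_bijective_of_isAlgClosed (A := B) (V := U) k).2 φ
    exact ⟨c, fun x => by rw [← hc]; rfl⟩
  refine eq_top_iff.2 fun a _ => ?_
  let f : Module.End (Module.End B U) U :=
    { toFun := a
      map_add' := a.map_add
      map_smul' := fun φ x => by
        obtain ⟨c, hc⟩ := hscal φ
        simp [Module.End.smul_def, hc] }
  let b := Module.finBasis k U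
  obtain ⟨r, hr⟩ := jacobson_density f (Set.finite_range b).toFinset
  have : a = r := b.ext fun i => hr (b i) (by simp)
  rw [this]
  exact r.2

/-- A nonzero space of endomorphisms stable under multiplication by an irreducible tuple is
everything. -/
theorem Module.End.eq_top_of_irreducible_of_mul_mem {k U ι : Type*} [Field k] [IsAlgClosed k]
    [AddCommGroup U] [Module k U] [FiniteDimensional k U] (B : ι → Module.End k U)
    (irr : ∀ W : Submodule k U, (∀ j, ∀ w ∈ W, B j w ∈ W) → W = ⊥ ∨ W = ⊤)
    (S : Submodule k (Module.End k U)) (hS : S ≠ ⊥) (hl : ∀ j, ∀ e ∈ S, B j * e ∈ S)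
    (hr : ∀ j, ∀ e ∈ S, e * B j ∈ S) : S = ⊤ := by
  obtain ⟨e, he, he0⟩ := S.exists_mem_ne_zero_of_ne_bot hS
  obtain ⟨x, hx⟩ : ∃ x, e x ≠ 0 := by
    by_contra! h
    exact he0 (LinearMap.ext h)
  have : Nontrivial U := ⟨_, _, hx⟩
  let N : Subalgebra k (Module.End k U) :=
    { carrier := {a | ∀ e ∈ S, a * e ∈ S ∧ e * a ∈ S}
      mul_mem' := fun {a b} ha hb e he => by
        rw [mul_assoc, ← mul_assoc e]
        exact ⟨(ha _ (hb _ he).1).1, (hb _ (ha _ he).2).2⟩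
      add_mem' := fun {a b} ha hb e he => by
        rw [add_mul, mul_add]
        exact ⟨S.add_mem (ha _ he).1 (hb _ he).1, S.add_mem (ha _ he).2 (hb _ he).2⟩
      algebraMap_mem' := fun c e he => by
        rw [← Algebra.commutes, ← Algebra.smul_def]
        exact ⟨S.smul_mem _ he, S.smul_mem _ he⟩ }
  have hN : N = ⊤ := N.eq_top_of_irreducible fun W hW =>
    irr W fun j w hw => hW (B j) (fun e he => ⟨hl j e he, hr j e he⟩) w hw
  have hmem : ∀ a, a ∈ N := fun a => hN ▸ Algebra.mem_top
  obtain ⟨ψ, hψ⟩ := Module.exists_dual_forall_apply_ne_zero (K := k) (fun _ : Unit => e x) fun _ => hx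
  refine Module.End.eq_top_of_forall_smulRight_mem S fun φ y => ?_
  have : φ.smulRight y = (ψ.smulRight ((ψ (e x))⁻¹ • y)) * (e * φ.smulRight x) := by
    ext z
    simp [smul_smul, hψ ()]
  rw [this]
  exact (hmem _ _ (hmem _ _ he).2).1

section

open DualNumber TrivSqZeroExt

/-- The product of the dual-number deformations `A j + ε A j` along a word: its components are the
evaluation of the word and its derivative with respect to the scaling `A ↦ t A` at `t = 1`. -/
def dualWord {k V : Type*} [Field k] [AddCommGroup V] [Module k V] {g : ℕ}
    (A : Fin g → Module.End k V) (w : List (Fin g)) : DualNumber (Module.End k V) :=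
  (w.map fun j => inl (A j) + inr (A j)).prod

/-- The span of the deformed nonempty words. -/
def dualSpan {k V : Type*} [Field k] [AddCommGroup V] [Module k V] {g : ℕ}
    (A : Fin g → Module.End k V) : Submodule k (DualNumber (Module.End k V)) :=
  Submodule.span k (Set.range fun p : Fin g × List (Fin g) => dualWord A (p.1 :: p.2))

theorem fst_dualWord {k V : Type*} [Field k] [AddCommGroup V] [Module k V] {g : ℕ}
    (A : Fin g → Module.End k V) (w : List (Fin g)) :
    (dualWord A w).fst = (w.map A).prod := by
  induction w with
  | nil => simp [dualWord]
  | cons j w ih => simp_all [dualWord]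

theorem snd_dualWord {k V : Type*} [Field k] [AddCommGroup V] [Module k V] {g : ℕ}
    (A : Fin g → Module.End k V) (w : List (Fin g)) :
    (dualWord A w).snd = (w.length : k) • (w.map A).prod := by
  induction w with
  | nil => simp [dualWord]
  | cons j w ih =>
    have := fst_dualWord A w
    simp_all [dualWord, add_smul]

theorem mul_mem_dualSpan {k V : Type*} [Field k] [AddCommGroup V] [Module k V] {g : ℕ}
    (A : Fin g → Module.End k V) {p q} (hp : p ∈ dualSpan A)
    (hq : q ∈ dualSpan A) : p * q ∈ dualSpan A := by
  have : dualSpan A * dualSpan A ≤ dualSpan A := by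
    unfold dualSpan
    rw [Submodule.span_mul_span, Submodule.span_le]
    rintro _ ⟨_, ⟨⟨j, u⟩, rfl⟩, _, ⟨⟨l, v⟩, rfl⟩, rfl⟩
    refine Submodule.subset_span ⟨(j, u ++ l :: v), ?_⟩
    simp [dualWord, mul_assoc]
  exact this (Submodule.mul_mem_mul hp hq)

/-- If every evaluation derivative vanished at the rank-one idempotents, scaling the tuple would be
an infinitesimal automorphism, forcing all words to have trace zero. -/
theorem exists_smulRight_snd_ne_zero {k U : Type*} [Field k] [CharZero k] [AddCommGroup U]
    [Module k U] [FiniteDimensional k U] [Nontrivial U] {g : ℕ} (B : Fin g → Module.End k U)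
    (E : Submodule k (DualNumber (Module.End k U))) (hE : E ≤ dualSpan B)
    (hmul : ∀ p ∈ E, ∀ q ∈ dualSpan B, p * q ∈ E) (htop : ∀ a, ∃ q ∈ E, q.fst = a) :
    ∃ (x : U) (φ : U →ₗ[k] k), φ x = 1 ∧ ∃ q ∈ E, q.fst = φ.smulRight x ∧ φ (q.snd x) ≠ 0 := by
  by_contra! H
  have hzero : ∀ q ∈ E, q.fst = 0 → q.snd = 0 := by
    intro q hq hq0
    ext x
    by_contra hx
    have hx0 : x ≠ 0 := by rintro rfl; simp at hx
    obtain ⟨φ, hφ⟩ := Module.exists_dual_forall_apply_ne_zero (K := k) ![x, q.snd x]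
      (by simpa [Fin.forall_fin_two] using ⟨hx0, hx⟩)
    have h1 : φ x ≠ 0 := hφ 0
    have h2 : φ (q.snd x) ≠ 0 := hφ 1
    have h3 : ((φ x)⁻¹ • φ) x = 1 := by simp [h1]
    obtain ⟨r, hr, hre⟩ := htop (((φ x)⁻¹ • φ).smulRight x)
    have e1 := H x _ h3 r hr hre
    have e2 := H x _ h3 (r + q) (E.add_mem hr hq) (by simp [hre, hq0])
    simp only [LinearMap.smul_apply, snd_add, LinearMap.add_apply, map_add, smul_eq_mul] at e1 e2
    rw [e1, zero_add] at e2
    exact mul_ne_zero (inv_ne_zero h1) h2 e2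
  have huniq : ∀ p ∈ E, ∀ q ∈ E, p.fst = q.fst → p = q := by
    intro p hp q hq h
    have := hzero (p - q) (E.sub_mem hp hq) (by simp [h])
    exact TrivSqZeroExt.ext h (sub_eq_zero.1 (by simpa using this))
  have hone : (1 : DualNumber (Module.End k U)) ∈ E := by
    obtain ⟨q, hq, hq1⟩ := htop 1
    have h := huniq (q * q) (hmul q hq q (hE hq)) q hq (by simp [hq1])
    have h2 := congrArg TrivSqZeroExt.snd h
    simp only [DualNumber.snd_mul, hq1, one_mul, mul_one, add_eq_left] at h2
    rwa [show q = 1 from TrivSqZeroExt.ext (by simp [hq1]) (by simp [h2])] at hq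
  let S : Submodule k (Module.End k U) :=
    { carrier := {a | ∃ q ∈ E, q.fst = a ∧ LinearMap.trace k U q.snd = 0}
      add_mem' := by
        rintro _ _ ⟨p, hp, rfl, hp0⟩ ⟨q, hq, rfl, hq0⟩
        exact ⟨p + q, E.add_mem hp hq, by simp, by simp [hp0, hq0]⟩
      zero_mem' := ⟨0, E.zero_mem, by simp, by simp⟩
      smul_mem' := by
        rintro c _ ⟨p, hp, rfl, hp0⟩
        exact ⟨c • p, E.smul_mem c hp, by simp, by simp [hp0]⟩ }
  have hS1 : ∀ (φ : U →ₗ[k] k) (x : U), φ x = 1 → φ.smulRight x ∈ S := by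
    intro φ x hφ
    obtain ⟨q, hq, hqe⟩ := htop (φ.smulRight x)
    refine ⟨q, hq, hqe, ?_⟩
    have hid : φ.smulRight x * φ.smulRight x = φ.smulRight x := by ext; simp [hφ]
    have h := congrArg TrivSqZeroExt.snd
      (huniq (q * q) (hmul q hq q (hE hq)) q hq (by simp [hqe, hid]))
    have h2 : LinearMap.trace k U (φ.smulRight x * q.snd) = 0 := by
      rw [LinearMap.trace_mul_comm,
        show q.snd * φ.smulRight x = φ.smulRight (q.snd x) by ext; simp, LinearMap.trace_smulRight]
      exact H x φ hφ q hq hqe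
    rw [← h, DualNumber.snd_mul, map_add, hqe, LinearMap.trace_mul_comm _ q.snd, h2, add_zero]
  have hS : S = ⊤ := by
    refine Module.End.eq_top_of_forall_smulRight_mem S fun φ x => ?_
    by_cases hx : x = 0
    · rw [hx, show φ.smulRight (0 : U) = 0 by ext; simp]
      exact S.zero_mem
    by_cases hφ : φ x = 0
    · obtain ⟨ψ, hψ⟩ := Module.exists_dual_forall_apply_ne_zero (K := k) (fun _ : Unit => x)
        fun _ => hx
      have h1 : ((ψ x)⁻¹ • ψ) x = 1 := by simp [hψ ()]
      have h2 : φ.smulRight x =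
          (φ + (ψ x)⁻¹ • ψ).smulRight x - ((ψ x)⁻¹ • ψ).smulRight x := by
        ext; simp [add_smul]
      rw [h2]
      exact S.sub_mem (hS1 _ _ (by rw [LinearMap.add_apply, hφ, h1, zero_add])) (hS1 _ _ h1)
    · have h2 : φ.smulRight x = φ x • ((φ x)⁻¹ • φ).smulRight x := by
        ext; simp [smul_smul, hφ]
      rw [h2]
      exact S.smul_mem _ (hS1 _ _ (by simp [hφ]))
  have htr : ∀ q ∈ E, LinearMap.trace k U q.snd = 0 := by
    intro q hq
    obtain ⟨p, hp, hpq, hp0⟩ := hS.ge (Submodule.mem_top (x := q.fst))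
    rwa [huniq q hq p hp hpq.symm]
  have hword : ∀ q ∈ dualSpan B, LinearMap.trace k U q.fst = 0 := by
    intro q hq
    induction hq using Submodule.span_induction with
    | mem q hq =>
      obtain ⟨⟨j, w⟩, rfl⟩ := hq
      have hw : dualWord B (j :: w) ∈ dualSpan B := Submodule.subset_span ⟨(j, w), rfl⟩
      have := htr _ (one_mul (dualWord B (j :: w)) ▸ hmul 1 hone _ hw)
      rw [snd_dualWord, map_smul, smul_eq_mul, mul_eq_zero] at this
      rw [fst_dualWord]
      exact this.resolve_left (Nat.cast_ne_zero.2 (by simp))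
    | zero => simp
    | add _ _ _ _ h1 h2 => simp [h1, h2]
    | smul c _ _ h => simp [h]
  obtain ⟨x, hx⟩ := exists_ne (0 : U)
  obtain ⟨φ, hφ⟩ := Module.exists_dual_forall_apply_ne_zero (K := k) (fun _ : Unit => x) fun _ => hx
  obtain ⟨q, hq, hqe⟩ := htop (φ.smulRight x)
  have := hword q (hE hq)
  rw [hqe, LinearMap.trace_smulRight] at this
  exact hφ () this

/-- If `U` is a minimal invariant subspace and some combination of words kills `V ⧸ U` but not `U`,
then some combination of words has `1` as a simple eigenvalue, in a way compatible with scaling. -/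
theorem exists_mem_dualSpan_simple {k V : Type*} [Field k] [IsAlgClosed k] [CharZero k]
    [AddCommGroup V] [Module k V] [FiniteDimensional k V] {g : ℕ} (A : Fin g → Module.End k V)
    (U : Submodule k V) (hU : ∀ j, ∀ u ∈ U, A j u ∈ U)
    (hmin : ∀ W ≤ U, (∀ j, ∀ w ∈ W, A j w ∈ W) → W = ⊥ ∨ W = U)
    (hex : ∃ p ∈ dualSpan A, (∀ v, p.fst v ∈ U) ∧ ∃ u ∈ U, p.fst u ≠ 0) :
    ∃ p ∈ dualSpan A, ∃ u : V, u ≠ 0 ∧ p.fst u = u ∧ (∀ x, p.fst x = x → ∃ c : k, x = c • u) ∧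
      ∀ y, ∀ c : k, y = p.fst y + c • p.snd u → c = 0 := by
  let B : Fin g → Module.End k U := fun j => (A j).restrict (hU j)
  let Res (p : DualNumber (Module.End k V)) (q : DualNumber (Module.End k U)) : Prop :=
    ∀ u : U, (q.fst u : V) = p.fst u ∧ (q.snd u : V) = p.snd u
  have res_add : ∀ p p' q q', Res p q → Res p' q' → Res (p + p') (q + q') :=
    fun p p' q q' h h' u => by simp [h u, h' u]
  have res_smul : ∀ (c : k) p q, Res p q → Res (c • p) (c • q) :=
    fun c p q h u => by simp [h u]
  have res_mul : ∀ p p' q q', Res p q → Res p' q' → Res (p * p') (q * q') :=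
    fun p p' q q' h h' u => by simp [h _, h' _]
  have res_word : ∀ w, Res (dualWord A w) (dualWord B w) := by
    intro w
    induction w with
    | nil => intro u; simp [dualWord]
    | cons j w ih =>
      have := res_mul (inl (A j) + inr (A j)) _ (inl (B j) + inr (B j)) _
        (fun u => by simp [B]) ih
      simpa [dualWord] using this
  have res_left : ∀ p ∈ dualSpan A, ∃ q ∈ dualSpan B, Res p q := by
    intro p hp
    induction hp using Submodule.span_induction with
    | mem p hp =>
      obtain ⟨⟨j, w⟩, rfl⟩ := hp
      exact ⟨_, Submodule.subset_span ⟨(j, w), rfl⟩, res_word _⟩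
    | zero => exact ⟨0, zero_mem _, fun u => by simp⟩
    | add p p' _ _ h h' =>
      obtain ⟨q, hq, h⟩ := h
      obtain ⟨q', hq', h'⟩ := h'
      exact ⟨q + q', add_mem hq hq', res_add _ _ _ _ h h'⟩
    | smul c p _ h =>
      obtain ⟨q, hq, h⟩ := h
      exact ⟨c • q, Submodule.smul_mem _ c hq, res_smul _ _ _ h⟩
  have res_right : ∀ q ∈ dualSpan B, ∃ p ∈ dualSpan A, Res p q := by
    intro q hq
    induction hq using Submodule.span_induction with
    | mem p hp =>
      obtain ⟨⟨j, w⟩, rfl⟩ := hp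
      exact ⟨_, Submodule.subset_span ⟨(j, w), rfl⟩, res_word _⟩
    | zero => exact ⟨0, zero_mem _, fun u => by simp⟩
    | add q q' _ _ h h' =>
      obtain ⟨p, hp, h⟩ := h
      obtain ⟨p', hp', h'⟩ := h'
      exact ⟨p + p', add_mem hp hp', res_add _ _ _ _ h h'⟩
    | smul c p _ h =>
      obtain ⟨q, hq, h⟩ := h
      exact ⟨c • q, Submodule.smul_mem _ c hq, res_smul _ _ _ h⟩
  have res_unique : ∀ p q q', Res p q → Res p q' → q = q' := by
    intro p q q' h h'
    refine TrivSqZeroExt.ext (LinearMap.ext fun u => Subtype.ext ?_)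
      (LinearMap.ext fun u => Subtype.ext ?_)
    · rw [(h u).1, (h' u).1]
    · rw [(h u).2, (h' u).2]
  let E : Submodule k (DualNumber (Module.End k U)) :=
    { carrier := {q | ∃ p ∈ dualSpan A, (∀ v, p.fst v ∈ U) ∧ Res p q}
      add_mem' := by
        rintro _ _ ⟨p, hp, hpU, h⟩ ⟨p', hp', hpU', h'⟩
        exact ⟨p + p', add_mem hp hp', fun v => U.add_mem (hpU v) (hpU' v), res_add _ _ _ _ h h'⟩
      zero_mem' := ⟨0, zero_mem _, fun v => by simp, fun u => by simp⟩
      smul_mem' := by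
        rintro c _ ⟨p, hp, hpU, h⟩
        exact ⟨c • p, Submodule.smul_mem _ c hp, fun v => U.smul_mem c (hpU v), res_smul _ _ _ h⟩ }
  have hE : E ≤ dualSpan B := by
    rintro q ⟨p, hp, -, h⟩
    obtain ⟨q', hq', h'⟩ := res_left p hp
    rwa [res_unique _ _ _ h h']
  have hmul : ∀ p ∈ E, ∀ q ∈ dualSpan B, p * q ∈ E := by
    rintro q ⟨p, hp, hpU, h⟩ q' hq'
    obtain ⟨p', hp', h'⟩ := res_right q' hq'
    exact ⟨p * p', mul_mem_dualSpan A hp hp', fun v => by simpa using hpU _, res_mul _ _ _ _ h h'⟩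
  have hgen : ∀ j, dualWord B [j] ∈ dualSpan B := fun j => Submodule.subset_span ⟨(j, []), rfl⟩
  have hmul' : ∀ j, ∀ q ∈ E, dualWord B [j] * q ∈ E := by
    rintro j q ⟨p, hp, hpU, h⟩
    refine ⟨dualWord A [j] * p, mul_mem_dualSpan A (Submodule.subset_span ⟨(j, []), rfl⟩) hp,
      fun v => ?_, res_mul _ _ _ _ (res_word _) h⟩
    simpa [fst_dualWord] using hU j _ (hpU v)
  let S : Submodule k (Module.End k U) :=
    { carrier := {a | ∃ q ∈ E, q.fst = a}
      add_mem' := by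
        rintro _ _ ⟨p, hp, rfl⟩ ⟨q, hq, rfl⟩
        exact ⟨p + q, E.add_mem hp hq, by simp⟩
      zero_mem' := ⟨0, E.zero_mem, by simp⟩
      smul_mem' := by
        rintro c _ ⟨p, hp, rfl⟩
        exact ⟨c • p, E.smul_mem c hp, by simp⟩ }
  obtain ⟨p, hp, hpU, u₀, hu₀, hpu₀⟩ := hex
  obtain ⟨q, -, hpq⟩ := res_left p hp
  have hq0 : q.fst ⟨u₀, hu₀⟩ ≠ 0 := fun h => hpu₀ (by rw [← (hpq ⟨u₀, hu₀⟩).1, h]; rfl)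
  have : Nontrivial U := ⟨_, _, hq0⟩
  have hS : S = ⊤ := by
    refine Module.End.eq_top_of_irreducible_of_mul_mem B ?_ S ?_ ?_ ?_
    · intro W hW
      rcases hmin (W.map U.subtype) (Submodule.map_subtype_le _ _) (by
        rintro j _ ⟨w, hw, rfl⟩
        exact ⟨B j w, hW j w hw, rfl⟩) with h | h
      · exact Or.inl (Submodule.map_injective_of_injective U.subtype_injective
          (by rw [h, Submodule.map_bot]))
      · right
        refine eq_top_iff.2 fun u _ => ?_
        obtain ⟨w, hw, hwu⟩ := h.ge u.2
        rwa [← Subtype.ext hwu]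
    · intro h
      have : q.fst ∈ S := ⟨q, ⟨p, hp, hpU, hpq⟩, rfl⟩
      rw [h, Submodule.mem_bot] at this
      exact hq0 (by rw [this]; rfl)
    · rintro j _ ⟨q, hq, rfl⟩
      exact ⟨_, hmul' j q hq, by simp [fst_dualWord]⟩
    · rintro j _ ⟨q, hq, rfl⟩
      exact ⟨_, hmul q hq _ (hgen j), by simp [fst_dualWord]⟩
  obtain ⟨x, φ, hφ, q, ⟨p, hp, hpU, hpq⟩, hqe, hne⟩ :=
    exists_smulRight_snd_ne_zero B E hE hmul fun a => hS.ge (Submodule.mem_top (x := a))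
  have hpf : ∀ u : U, p.fst u = φ u • (x : V) := fun u => by rw [← (hpq u).1, hqe]; rfl
  refine ⟨p, hp, x, ?_, ?_, ?_, ?_⟩
  · intro h
    rw [show x = 0 from Subtype.ext h] at hφ
    simp at hφ
  · rw [hpf, hφ, one_smul]
  · intro y hy
    have hyU : y ∈ U := hy ▸ hpU y
    exact ⟨φ ⟨y, hyU⟩, by rw [← hpf]; exact hy.symm⟩
  · intro y c hy
    rw [← (hpq x).2] at hy
    have hyU : y ∈ U := by rw [hy]; exact U.add_mem (hpU y) (U.smul_mem c (Subtype.prop _))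
    have h : (⟨y, hyU⟩ : U) = φ ⟨y, hyU⟩ • x + c • q.snd x := by
      refine Subtype.ext ?_
      simpa [← hpf] using hy
    have h2 := congrArg φ h
    simpa [hφ, hne] using h2

open Polynomial in
theorem Polynomial.aeval_comp_of_intertwine {k V W : Type*} [Field k] [AddCommGroup V] [Module k V]
    [AddCommGroup W] [Module k W] {S : Module.End k V} {T : Module.End k W} (π : V →ₗ[k] W)
    (h : ∀ v, π (S v) = T (π v)) (q : k[X]) (v : V) : π (aeval S q v) = aeval T q (π v) := by
  induction q using Polynomial.induction_on' with
  | add p q hp hq => simp [hp, hq]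
  | monomial n a =>
    have : ∀ n, ∀ v, π ((S ^ n) v) = (T ^ n) (π v) := by
      intro n
      induction n with
      | zero => simp
      | succ n ih => intro v; simp [pow_succ, ih, h]
    simp [aeval_monomial, Module.algebraMap_end_apply, this]

/-- The coordinate-free form of `∑ j, A j ⊗ X j`, acting on `σ → V ≃ V ⊗ k ^ σ`. -/
def pencilMap {k V σ : Type*} [Field k] [AddCommGroup V] [Module k V] [Fintype σ] {g : ℕ}
    (A : Fin g → Module.End k V) (X : Fin g → Matrix σ σ k) : Module.End k (σ → V) :=
  LinearMap.pi fun i => ∑ j, ∑ m, X j i m • (A j ∘ₗ LinearMap.proj m)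

theorem pencilMap_apply {k V σ : Type*} [Field k] [AddCommGroup V] [Module k V] [Fintype σ] {g : ℕ}
    (A : Fin g → Module.End k V) (X : Fin g → Matrix σ σ k) (v : σ → V) (i : σ) :
    pencilMap A X v i = ∑ j, ∑ m, X j i m • A j (v m) := by
  simp [pencilMap]

open Polynomial in
/-- If the restriction of the pencil to `U` is singular at a point where the quotient pencil is not,
then some combination of words kills `V ⧸ U` but not `U`. -/
theorem exists_mem_dualSpan_of_separated {k V : Type*} [Field k]
    [AddCommGroup V] [Module k V] [FiniteDimensional k V] {g n : ℕ} (A : Fin g → Module.End k V)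
    (U : Submodule k V) (hU : ∀ j, U ≤ U.comap (A j)) (Z : Fin g → Matrix (Fin n) (Fin n) k)
    (v : Fin n → V) (hv : v ≠ 0) (hTv : pencilMap A Z v = v)
    (hQ : ∀ w, pencilMap (fun j => U.mapQ U (A j) (hU j)) Z w = w → w = 0) :
    ∃ p ∈ dualSpan A, (∀ v, p.fst v ∈ U) ∧ ∃ u ∈ U, p.fst u ≠ 0 := by
  set T := pencilMap A Z with hT
  set TQ := pencilMap (fun j => U.mapQ U (A j) (hU j)) Z with hTQ
  let π : (Fin n → V) →ₗ[k] (Fin n → V ⧸ U) := LinearMap.pi fun i => U.mkQ ∘ₗ LinearMap.proj i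
  have hπ : ∀ v, π (T v) = TQ (π v) := by
    intro v
    ext i
    simp [π, hT, hTQ, pencilMap_apply]
  have hvU : ∀ i, v i ∈ U := by
    have := hQ (π v) (by rw [← hπ, hTv])
    intro i
    simpa [π] using congrFun this i
  let N : Submodule k (Module.End k (Fin n → V)) :=
    { carrier := {Φ | ∀ i m, ∃ p ∈ dualSpan A, ∀ x, Φ (Pi.single m x) i = p.fst x}
      add_mem' := fun {Φ Ψ} h h' i m => by
        obtain ⟨p, hp, h⟩ := h i m
        obtain ⟨q, hq, h'⟩ := h' i m
        exact ⟨p + q, add_mem hp hq, fun x => by simp [h, h']⟩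
      zero_mem' := fun i m => ⟨0, zero_mem _, fun x => by simp⟩
      smul_mem' := fun c Φ h i m => by
        obtain ⟨p, hp, h⟩ := h i m
        exact ⟨c • p, Submodule.smul_mem _ c hp, fun x => by simp [h]⟩ }
  have hsum : ∀ (Φ : Module.End k (Fin n → V)) (w : Fin n → V) i,
      Φ w i = ∑ m, Φ (Pi.single m (w m)) i := by
    intro Φ w i
    conv_lhs => rw [← Finset.univ_sum_single w]
    simp
  have hNT : T ∈ N := by
    intro i m
    refine ⟨∑ j, Z j i m • dualWord A [j], Submodule.sum_mem _ fun j _ => Submodule.smul_mem _ _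
      (Submodule.subset_span ⟨(j, []), rfl⟩), fun x => ?_⟩
    rw [hT, pencilMap_apply, ← TrivSqZeroExt.fstHom_apply (S := k), map_sum, LinearMap.sum_apply]
    refine Finset.sum_congr rfl fun j _ => ?_
    rw [Finset.sum_eq_single m (by intro l _ hl; simp [hl]) (by simp)]
    simp [fst_dualWord]
  have hNmul : ∀ Φ ∈ N, ∀ Ψ ∈ N, Φ * Ψ ∈ N := by
    intro Φ hΦ Ψ hΨ i m
    choose p hp hpe using hΦ
    choose q hq hqe using hΨ
    refine ⟨∑ l, p i l * q l m, Submodule.sum_mem _ fun l _ => mul_mem_dualSpan A (hp _ _) (hq _ _),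
      fun x => ?_⟩
    rw [Module.End.mul_apply, hsum, ← TrivSqZeroExt.fstHom_apply (S := k), map_sum,
      LinearMap.sum_apply]
    simp [hpe, hqe]
  have hNpow : ∀ r : ℕ, T ^ (r + 1) ∈ N := by
    intro r
    induction r with
    | zero => simpa using hNT
    | succ r ih => rw [pow_succ]; exact hNmul _ ih _ hNT
  have hNaeval : ∀ q : k[X], aeval T (X * q) ∈ N := by
    intro q
    induction q using Polynomial.induction_on' with
    | add p q hp hq => rw [mul_add, map_add]; exact N.add_mem hp hq
    | monomial r a =>
      rw [X_mul_monomial, aeval_monomial, ← Algebra.smul_def]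
      exact N.smul_mem _ (hNpow r)
  set χ := minpoly k TQ
  have hχ : χ.eval 1 ≠ 0 := by
    intro h
    obtain ⟨w, hw⟩ := (Module.End.hasEigenvalue_iff_isRoot.2 h).exists_hasEigenvector
    exact hw.2 (hQ w (by simpa using hw.apply_eq_smul))
  have hΦv : aeval T (X * χ) v = χ.eval 1 • v := by
    rw [Module.End.aeval_apply_of_hasEigenvector (μ := 1)
      ⟨Module.End.mem_eigenspace_iff.2 (by simpa using hTv), hv⟩]
    simp
  obtain ⟨i, hi⟩ : ∃ i, v i ≠ 0 := by
    by_contra! h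
    exact hv (funext h)
  have hΦi : aeval T (X * χ) v i ≠ 0 := by
    rw [hΦv]
    exact smul_ne_zero hχ hi
  rw [hsum] at hΦi
  obtain ⟨m, -, hm⟩ := Finset.exists_ne_zero_of_sum_ne_zero hΦi
  obtain ⟨p, hp, hpe⟩ := hNaeval χ i m
  refine ⟨p, hp, fun x => ?_, v m, hvU m, by rwa [← hpe]⟩
  have := congrFun (aeval_comp_of_intertwine π hπ (X * χ) (Pi.single m x)) i
  rw [map_mul (aeval TQ), minpoly.aeval, mul_zero] at this
  rw [← hpe]
  simpa [π] using this

/-- Coordinates identifying the space on which `pencilEval` acts with `Fin n → V`. -/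
def pencilCoord {k V : Type*} [Field k] [AddCommGroup V] [Module k V] {d : ℕ}
    (b : Module.Basis (Fin d) k V) (n : ℕ) : (Fin d × Fin n → k) ≃ₗ[k] (Fin n → V) :=
  LinearEquiv.funCongrLeft k k (Equiv.prodComm (Fin n) (Fin d)) ≪≫ₗ
    LinearEquiv.curry k k (Fin n) (Fin d) ≪≫ₗ LinearEquiv.piCongrRight fun _ => b.equivFun.symm

theorem pencilCoord_apply {k V : Type*} [Field k] [AddCommGroup V] [Module k V] {d : ℕ}
    (b : Module.Basis (Fin d) k V) (n : ℕ) (v : Fin d × Fin n → k) (i : Fin n) :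
    pencilCoord b n v i = ∑ a, v (a, i) • b a := by
  simp [pencilCoord, Module.Basis.equivFun_symm_apply, LinearMap.funLeft]

theorem pencilCoord_mulVec {k V : Type*} [Field k] [AddCommGroup V] [Module k V] {g d n : ℕ}
    (b : Module.Basis (Fin d) k V) (A : Fin g → Module.End k V)
    (X : Fin g → Matrix (Fin n) (Fin n) k) (v : Fin d × Fin n → k) :
    pencilCoord b n (pencilEval (fun j => LinearMap.toMatrix b b (A j)) X *ᵥ v) =
      pencilCoord b n v - pencilMap A X (pencilCoord b n v) := by
  rw [pencilEval, Matrix.sub_mulVec, Matrix.one_mulVec, map_sub, Matrix.sum_mulVec, map_sum]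
  congr 1
  ext i
  rw [pencilMap_apply, Finset.sum_apply]
  refine Finset.sum_congr rfl fun j _ => ?_
  simp only [pencilCoord_apply, mulVec, dotProduct, Fintype.sum_prod_type, Matrix.kroneckerMap_apply,
    Matrix.map_apply, Algebra.algebraMap_self, RingHom.id_apply, map_sum, map_smul,
    Finset.smul_sum, Finset.sum_smul]
  have h : ∀ c, A j (b c) = ∑ a, LinearMap.toMatrix b b (A j) a c • b a := fun c => by
    simp_rw [LinearMap.toMatrix_apply, b.sum_repr]
  simp_rw [h, Finset.smul_sum, smul_smul]
  rw [Finset.sum_comm]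
  conv_rhs => rw [Finset.sum_comm]
  refine Finset.sum_congr rfl fun c _ => ?_
  rw [Finset.sum_comm]
  refine Finset.sum_congr rfl fun m _ => Finset.sum_congr rfl fun a _ => ?_
  congr 1
  ring

theorem det_pencilEval_eq_zero_iff {k V : Type*} [Field k] [AddCommGroup V] [Module k V]
    {g d n : ℕ} (b : Module.Basis (Fin d) k V) (A : Fin g → Module.End k V)
    (X : Fin g → Matrix (Fin n) (Fin n) k) :
    (pencilEval (fun j => LinearMap.toMatrix b b (A j)) X).det = 0 ↔
      ∃ v, v ≠ 0 ∧ pencilMap A X v = v := by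
  rw [← Matrix.exists_mulVec_eq_zero_iff]
  constructor
  · rintro ⟨v, hv, h⟩
    refine ⟨pencilCoord b n v, by simpa using hv, ?_⟩
    have := pencilCoord_mulVec b A X v
    rw [h, map_zero] at this
    exact (sub_eq_zero.1 this.symm).symm
  · rintro ⟨v, hv, h⟩
    refine ⟨(pencilCoord b n).symm v, by simpa using hv, (pencilCoord b n).injective ?_⟩
    rw [pencilCoord_mulVec, LinearEquiv.apply_symm_apply, h, sub_self, map_zero]

/-- `T` has the fixed vector `v₀`, and the eigenvalue `1` of `T` is algebraically simple. -/
def HasSimpleFixedVector {k M : Type*} [Field k] [AddCommGroup M] [Module k M]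
    (T : Module.End k M) : Prop :=
  ∃ v₀ ≠ 0, T v₀ = v₀ ∧ ∀ v, T (v - T v) = v - T v → ∃ c : k, v = c • v₀

/-- Realization of a combination of words by a pencil on a space of words. -/
theorem exists_pencilMap_hasSimpleFixedVector {k V : Type*} [Field k]
    [AddCommGroup V] [Module k V] {g : ℕ} (A : Fin g → Module.End k V)
    (p : DualNumber (Module.End k V)) (hp : p ∈ dualSpan A) (u : V) (hu : u ≠ 0)
    (hpu : p.fst u = u) (hfix : ∀ x, p.fst x = x → ∃ c : k, x = c • u)
    (hsimple : ∀ y, ∀ c : k, y = p.fst y + c • p.snd u → c = 0) :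
    ∃ (s : Finset (List (Fin g))) (X : Fin g → Matrix s s k),
      HasSimpleFixedVector (pencilMap A X) := by
  obtain ⟨c, rfl⟩ := Finsupp.mem_span_range_iff_exists_finsupp.1 hp
  let N := c.support.sup (fun q => q.2.length) + 1
  let s := (List.finite_length_lt (Fin g) N).toFinset
  have hs : ∀ w, w ∈ s ↔ w.length < N := fun w => by simp [s]
  have hnil : [] ∈ s := (hs _).2 (by simp [N])
  have htail : ∀ j w, j :: w ∈ s → w ∈ s := fun j w h => by
    rw [hs] at h ⊢
    exact (Nat.lt_succ_self _).trans h
  have hsub : c.support ⊆ Finset.univ ×ˢ s := fun q hq => by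
    simpa [hs, N, Nat.lt_succ_iff] using Finset.le_sup (f := fun q => q.2.length) hq
  let ev : List (Fin g) → Module.End k V := fun w => (w.map A).prod
  have hev : ∀ j w x, ev (j :: w) x = A j (ev w x) := fun j w x => by simp [ev]
  have hfst : ∀ x, (c.sum fun q a => a • dualWord A (q.1 :: q.2)).fst x =
      ∑ j, ∑ m : s, c (j, m) • A j (ev m x) := by
    intro x
    rw [Finsupp.sum_of_support_subset c hsub _ (by simp), ← TrivSqZeroExt.fstHom_apply (S := k),
      map_sum, LinearMap.sum_apply, Finset.sum_product]
    refine Finset.sum_congr rfl fun j _ => ?_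
    rw [← Finset.sum_coe_sort]
    refine Finset.sum_congr rfl fun m _ => ?_
    simp [fst_dualWord, ev]
  have hsnd : ∀ x, (c.sum fun q a => a • dualWord A (q.1 :: q.2)).snd x =
      ∑ j, ∑ m : s, c (j, m) • ((m.1.length : k) + 1) • A j (ev m x) := by
    intro x
    rw [Finsupp.sum_of_support_subset c hsub _ (by simp), TrivSqZeroExt.snd_sum,
      LinearMap.sum_apply, Finset.sum_product]
    refine Finset.sum_congr rfl fun j _ => ?_
    rw [← Finset.sum_coe_sort]
    refine Finset.sum_congr rfl fun m _ => ?_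
    simp [snd_dualWord, ev]
  set p := c.sum fun q a => a • dualWord A (q.1 :: q.2)
  let X : Fin g → Matrix s s k := fun j => Matrix.of fun i m =>
    (if i.1 = j :: m.1 then 1 else 0) + (if i.1 = [] then c (j, m) else 0)
  have hTnil : ∀ v, pencilMap A X v ⟨[], hnil⟩ = ∑ j, ∑ m : s, c (j, m) • A j (v m) := by
    intro v
    simp [pencilMap_apply, X]
  have hTcons : ∀ v j w (h : j :: w ∈ s),
      pencilMap A X v ⟨j :: w, h⟩ = A j (v ⟨w, htail j w h⟩) := by
    intro v j w h
    rw [pencilMap_apply, Finset.sum_eq_single j, Finset.sum_eq_single ⟨w, htail j w h⟩]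
    · simp [X]
    · rintro m - hm
      have : w ≠ m.1 := fun h => hm (Subtype.ext h.symm)
      simp [X, this]
    · simp
    · rintro l - hl
      simp [X, hl.symm]
    · simp
  refine ⟨s, X, fun w => ev w u, fun h => hu ?_, ?_, ?_⟩
  · simpa [ev] using congrFun h ⟨[], hnil⟩
  · ext ⟨w, hw⟩
    cases w with
    | nil => rw [hTnil, ← hfst, hpu]; simp [ev]
    | cons j w => rw [hTcons, hev]
  · intro v hv
    set v' := v - pencilMap A X v with hv'
    set x := v' ⟨[], hnil⟩
    set y := v ⟨[], hnil⟩
    have hv'w : ∀ w (h : w ∈ s), v' ⟨w, h⟩ = ev w x := by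
      intro w
      induction w with
      | nil => intro h; simp [ev, x]
      | cons j w ih => intro h; rw [← congrFun hv, hTcons, ih, hev]
    have hx : p.fst x = x := by
      have := congrFun hv ⟨[], hnil⟩
      rw [hTnil] at this
      simp_rw [hv'w] at this
      rwa [hfst]
    obtain ⟨a, ha⟩ := hfix x hx
    have hvadd : ∀ i, v i = pencilMap A X v i + v' i := fun i => by simp [hv']
    have hvw : ∀ w (h : w ∈ s), v ⟨w, h⟩ = ev w y + (w.length : k) • ev w x := by
      intro w
      induction w with
      | nil => intro h; simp [ev, y]
      | cons j w ih =>
        intro h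
        rw [hvadd, hTcons, ih, hv'w, hev, hev, map_add, map_smul, List.length_cons, Nat.cast_succ,
          add_smul, one_smul, add_assoc]
    have hy : y = p.fst y + a • p.snd u := by
      have h1 : y = _ := hvadd ⟨[], hnil⟩
      rw [hTnil] at h1
      simp_rw [hvw] at h1
      rw [← map_smul, ← ha, hsnd, hfst]
      have h2 : v' ⟨[], hnil⟩ = ∑ j, ∑ m : s, c (j, m) • A j (ev m x) := by rw [← hfst, hx]
      rw [h2] at h1
      refine h1.trans ?_
      simp only [← Finset.sum_add_distrib]
      refine Finset.sum_congr rfl fun j _ => Finset.sum_congr rfl fun m _ => ?_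
      simp only [map_add, map_smul, smul_add, add_smul, one_smul, add_assoc]
    have ha0 := hsimple y a hy
    subst ha0
    rw [zero_smul] at ha
    obtain ⟨b, hb⟩ := hfix y (by simpa using hy.symm)
    refine ⟨b, funext fun ⟨w, hw⟩ => ?_⟩
    rw [hvw, ha, hb]
    simp

theorem HasSimpleFixedVector.exists_pad {k V σ : Type*} [Field k] [AddCommGroup V] [Module k V]
    [Fintype σ] {g n : ℕ} (A : Fin g → Module.End k V) (X : Fin g → Matrix σ σ k)
    (h : HasSimpleFixedVector (pencilMap A X)) (hn : Fintype.card σ ≤ n) :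
    ∃ Y : Fin g → Matrix (Fin n) (Fin n) k, HasSimpleFixedVector (pencilMap A Y) := by
  classical
  obtain ⟨v₀, hv₀, hfix, hsimple⟩ := h
  obtain ⟨e⟩ : Nonempty (σ ↪ Fin n) := Function.Embedding.nonempty_of_card_le (by simpa using hn)
  let Y : Fin g → Matrix (Fin n) (Fin n) k := fun j => Matrix.of fun i m =>
    ∑ a, ∑ b, if e a = i ∧ e b = m then X j a b else 0
  have hY : ∀ v a, pencilMap A Y v (e a) = pencilMap A X (v ∘ e) a := by
    intro v a
    rw [pencilMap_apply, pencilMap_apply]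
    refine Finset.sum_congr rfl fun j _ => ?_
    have : ∀ m, Y j (e a) m = ∑ b, if e b = m then X j a b else 0 := by
      intro m
      simp only [Y, Matrix.of_apply]
      rw [Finset.sum_eq_single a (by intro b _ hb; simp [hb]) (by simp)]
      simp
    simp_rw [this, Finset.sum_smul]
    rw [Finset.sum_comm]
    refine Finset.sum_congr rfl fun b _ => ?_
    rw [Finset.sum_eq_single (e b) (by intro m _ hm; simp [hm.symm]) (by simp)]
    simp
  have hY0 : ∀ v i, (∀ a, e a ≠ i) → pencilMap A Y v i = 0 := by
    intro v i hi
    simp [pencilMap_apply, Y, hi]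
  let w₀ : Fin n → V := Function.extend e v₀ 0
  have hw₀ : w₀ ∘ e = v₀ := funext fun a => e.injective.extend_apply _ _ _
  have hw₀' : ∀ i, (∀ a, e a ≠ i) → w₀ i = 0 := fun i hi =>
    Function.extend_apply' _ _ _ fun ⟨a, ha⟩ => hi a ha
  refine ⟨Y, w₀, ?_, ?_, ?_⟩
  · intro h
    rw [h] at hw₀
    exact hv₀ hw₀.symm
  · ext i
    by_cases hi : ∃ a, e a = i
    · obtain ⟨a, rfl⟩ := hi
      rw [hY, hw₀, hfix, ← hw₀, Function.comp_apply]
    · push Not at hi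
      rw [hY0 _ _ hi, hw₀' _ hi]
  · intro v hv
    have hcomp : (v - pencilMap A Y v) ∘ e = v ∘ e - pencilMap A X (v ∘ e) := by
      ext a; simp [hY]
    obtain ⟨c, hc⟩ := hsimple (v ∘ e) (by
      rw [← hcomp]
      ext a
      rw [← hY, hv, Function.comp_apply])
    refine ⟨c, funext fun i => ?_⟩
    by_cases hi : ∃ a, e a = i
    · obtain ⟨a, rfl⟩ := hi
      rw [Pi.smul_apply, ← Function.comp_apply (f := v), ← Function.comp_apply (f := w₀), hc, hw₀]
      rfl
    · push Not at hi
      have h1 := congrFun hv i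
      rw [hY0 _ _ hi, Pi.sub_apply, hY0 _ _ hi, sub_zero] at h1
      rw [← h1, Pi.smul_apply, hw₀' i hi, smul_zero]

theorem exists_minimal_invariant_submodule {k V : Type*} [Field k] [AddCommGroup V] [Module k V]
    [FiniteDimensional k V] [Nontrivial V] {ι : Type*} (A : ι → Module.End k V) :
    ∃ U : Submodule k V, U ≠ ⊥ ∧ (∀ j, ∀ u ∈ U, A j u ∈ U) ∧
      ∀ W ≤ U, (∀ j, ∀ w ∈ W, A j w ∈ W) → W = ⊥ ∨ W = U := by
  obtain ⟨U, ⟨hU, hUA⟩, hmin⟩ := (wellFounded_lt (α := Submodule k V)).has_min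
    {U | U ≠ ⊥ ∧ ∀ j, ∀ u ∈ U, A j u ∈ U} ⟨⊤, top_ne_bot, fun _ _ _ => trivial⟩
  refine ⟨U, hU, hUA, fun W hW hWA => or_iff_not_imp_left.2 fun hW0 => ?_⟩
  exact hW.eq_of_not_lt (hmin W ⟨hW0, hWA⟩)

/-- Singularity of the quotient pencil implies singularity of the pencil. -/
theorem exists_pencilMap_fixed_of_mapQ {k V : Type*} [Field k] [AddCommGroup V] [Module k V]
    [FiniteDimensional k V] {g n : ℕ} (A : Fin g → Module.End k V) (U : Submodule k V)
    (hU : ∀ j, U ≤ U.comap (A j)) (X : Fin g → Matrix (Fin n) (Fin n) k)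
    (hQ : ∃ w, w ≠ 0 ∧ pencilMap (fun j => U.mapQ U (A j) (hU j)) X w = w) :
    ∃ v, v ≠ 0 ∧ pencilMap A X v = v := by
  by_contra! h
  have hinj : Function.Injective ⇑(1 - pencilMap A X : Module.End k _) := by
    rw [injective_iff_map_eq_zero]
    intro v hv
    by_contra hv0
    exact h v hv0 (sub_eq_zero.1 hv).symm
  have hsurj := LinearMap.injective_iff_surjective.1 hinj
  have hsurjQ : Function.Surjective
      ⇑(1 - pencilMap (fun j => U.mapQ U (A j) (hU j)) X : Module.End k _) := by
    intro w
    choose v hv using fun i => U.mkQ_surjective (w i)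
    obtain ⟨z, hz⟩ := hsurj v
    refine ⟨fun i => U.mkQ (z i), funext fun i => ?_⟩
    rw [← hv i, ← congrFun hz i]
    simp [pencilMap_apply, -Submodule.mkQ_apply]
    rfl
  obtain ⟨w, hw, hw1⟩ := hQ
  refine hw (LinearMap.injective_iff_surjective.2 hsurjQ ?_)
  simp [hw1]

theorem finrank_ker_pencilEval_mul_self {k V : Type*} [Field k] [AddCommGroup V] [Module k V]
    {g d n : ℕ} (b : Module.Basis (Fin d) k V) (A : Fin g → Module.End k V)
    (X : Fin g → Matrix (Fin n) (Fin n) k) (h : HasSimpleFixedVector (pencilMap A X)) :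
    Module.finrank k (LinearMap.ker
      (pencilEval (fun j => LinearMap.toMatrix b b (A j)) X *
        pencilEval (fun j => LinearMap.toMatrix b b (A j)) X).mulVecLin) = 1 := by
  obtain ⟨v₀, hv₀, hfix, hsimple⟩ := h
  set e := pencilCoord b n
  set M := pencilEval (fun j => LinearMap.toMatrix b b (A j)) X
  have hM : ∀ v, e (M *ᵥ v) = e v - pencilMap A X (e v) := pencilCoord_mulVec b A X
  have hker : M *ᵥ e.symm v₀ = 0 := e.injective (by simp [hM, hfix])
  let w₀ : LinearMap.ker (M * M).mulVecLin :=
    ⟨e.symm v₀, by simp [hker]⟩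
  refine (finrank_eq_one_iff_of_nonzero' w₀ fun h => hv₀ ?_).2 fun ⟨w, hw⟩ => ?_
  · simpa [w₀] using congrArg Subtype.val h
  · rw [LinearMap.mem_ker, Matrix.mulVecLin_apply, ← Matrix.mulVec_mulVec] at hw
    have h2 := congrArg e hw
    rw [hM, hM, map_zero, sub_eq_zero] at h2
    obtain ⟨c, hc⟩ := hsimple (e w) h2.symm
    exact ⟨c, Subtype.ext (e.injective (by simp [w₀, hc]))⟩

end

/-- If `L ≠ I` is an FL-minimal monic pencil, then for all sufficiently large `n` there is a
point `X ∈ FL_n(L)` at which the zero eigenvalue of `L(X)` has algebraic multiplicity one. -/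
theorem exists_algebraic_multiplicity_one_of_flMinimal
    {k : Type*} [Field k] [IsAlgClosed k] [CharZero k] {g d : ℕ}
    (A : Fin g → Matrix (Fin d) (Fin d) k) (hA : A ≠ 0)
    (hmin : ∀ (d' : ℕ) (A' : Fin g → Matrix (Fin d') (Fin d') k),
      (∀ (n : ℕ) (X : Fin g → Matrix (Fin n) (Fin n) k),
        (pencilEval A' X).det = 0 ↔ (pencilEval A X).det = 0) → d ≤ d') :
    ∃ n₀ : ℕ, ∀ n ≥ n₀, ∃ X : Fin g → Matrix (Fin n) (Fin n) k,
      (pencilEval A X).det = 0 ∧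
      Module.finrank k (LinearMap.ker (pencilEval A X * pencilEval A X).mulVecLin) = 1 := by
  let b := Pi.basisFun k (Fin d)
  let B : Fin g → Module.End k (Fin d → k) := fun j => Matrix.toLin b b (A j)
  have hAB : A = fun j => LinearMap.toMatrix b b (B j) :=
    funext fun j => (LinearMap.toMatrix_toLin b b (A j)).symm
  have : Nonempty (Fin d) := by
    by_contra h
    rw [not_nonempty_iff] at h
    exact hA (Subsingleton.elim _ _)
  obtain ⟨U, hU0, hU, hUmin⟩ := exists_minimal_invariant_submodule B
  have hlt : Module.finrank k ((Fin d → k) ⧸ U) < d := by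
    have h1 := U.finrank_quotient_add_finrank
    have h2 := Submodule.one_le_finrank_iff.2 hU0
    rw [Module.finrank_fin_fun] at h1
    omega
  let C : Fin g → Module.End k ((Fin d → k) ⧸ U) := fun j => U.mapQ U (B j) (hU j)
  let bQ := Module.finBasis k ((Fin d → k) ⧸ U)
  have hsep := mt (hmin _ fun j => LinearMap.toMatrix bQ bQ (C j)) hlt.not_ge
  simp only [not_forall] at hsep
  obtain ⟨m, Z, hZ⟩ := hsep
  rw [hAB, det_pencilEval_eq_zero_iff, det_pencilEval_eq_zero_iff] at hZ
  have hBZ : ∃ v, v ≠ 0 ∧ pencilMap B Z v = v := by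
    by_contra h
    exact hZ ⟨exists_pencilMap_fixed_of_mapQ B U hU Z, fun h' => absurd h' h⟩
  obtain ⟨v, hv, hBv⟩ := hBZ
  have hQ : ∀ w, pencilMap C Z w = w → w = 0 := fun w hw => by
    by_contra hw0
    exact hZ ⟨fun _ => ⟨v, hv, hBv⟩, fun _ => ⟨w, hw0, hw⟩⟩
  obtain ⟨p, hp, u, hu, hpu, hfix, hsimple⟩ := exists_mem_dualSpan_simple B U hU hUmin
    (exists_mem_dualSpan_of_separated B U hU Z v hv hBv hQ)
  obtain ⟨s, X, hX⟩ := exists_pencilMap_hasSimpleFixedVector B p hp u hu hpu hfix hsimple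
  refine ⟨Fintype.card s, fun n hn => ?_⟩
  obtain ⟨Y, hY⟩ := hX.exists_pad B X hn
  refine ⟨Y, ?_, ?_⟩
  · rw [hAB, det_pencilEval_eq_zero_iff]
    obtain ⟨v₀, hv₀, hfix, -⟩ := hY
    exact ⟨v₀, hv₀, hfix⟩
  · rw [hAB]
    exact finrank_ker_pencilEval_mul_self b B Y hY
end
end
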